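/- Let m, n ≥ 2, d ≥ 1, and 1 ≤ r ≤ min{m,n}−1 be integers. If a and a' are integers with 0 ≤ a, a' ≤ rd and a ≠ a', then closure(O_a) does not contain closure(O_{a'}), the closures being taken in the metric space POL_{d,m×n}. -/

import Mathlib

open Matrix Finset

namespace MPoly

/-- The space `POL_{d,m×n}` of `m × n` complex matrix polynomials of grade `d`,
identified with the tuple of coefficients `(A_0, …, A_d)`. -/
abbrev Pol (d m n : ℕ) := Fin (d+1) → Matrix (Fin m) (Fin n) ℂ

/-- A matrix pencil `λ A + B` of size `p × q`, identified with the pair `(A, B)`. -/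
abbrev Pencil (p q : ℕ) := Matrix (Fin p) (Fin q) ℂ × Matrix (Fin p) (Fin q) ℂ

/-- The metric on `POL_{d,m×n}`:  `dist(P,P') = (Σ_i ‖A_i − A'_i‖_F²)^(1/2)`. -/
noncomputable def polDist {m n d : ℕ} (P P' : Pol d m n) : ℝ :=
  Real.sqrt (∑ k, ∑ i, ∑ j, ‖P k i j - P' k i j‖ ^ 2)

/-- The Frobenius norm of a matrix polynomial: `‖P‖_F = (Σ_i ‖A_i‖_F²)^(1/2)`. -/
noncomputable def polNorm {m n d : ℕ} (P : Pol d m n) : ℝ :=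
  Real.sqrt (∑ k, ∑ i, ∑ j, ‖P k i j‖ ^ 2)

/-- The metric on pencils: `dist(λA+B, λA'+B') = (‖A−A'‖_F² + ‖B−B'‖_F²)^(1/2)`. -/
noncomputable def penDist {p q : ℕ} (L L' : Pencil p q) : ℝ :=
  Real.sqrt ((∑ i, ∑ j, ‖L.1 i j - L'.1 i j‖ ^ 2) + (∑ i, ∑ j, ‖L.2 i j - L'.2 i j‖ ^ 2))

/-- The `λ`-part `A = diag(A_d, I_n, …, I_n)` of the first companion form. -/
noncomputable def compA (m n d : ℕ) (P : Pol d m n) :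
    Matrix (Fin (m + n*(d-1))) (Fin (n*d)) ℂ := fun i j =>
  if hi : (i : ℕ) < m then
    if hj : (j : ℕ) < n then P (Fin.last d) ⟨i, hi⟩ ⟨j, hj⟩ else 0
  else if (i : ℕ) - m = (j : ℕ) - n ∧ n ≤ (j : ℕ) then 1 else 0

/-- The constant part `B` of the first companion form: first block row
`(A_{d-1}, …, A_0)`, with `−I_n` in block entries `(i+1, i)`. -/
noncomputable def compB (m n d : ℕ) (P : Pol d m n) :
    Matrix (Fin (m + n*(d-1))) (Fin (n*d)) ℂ := fun i j =>
  if hi : (i : ℕ) < m then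
    if hn : 0 < n then
      P ⟨d - 1 - (j : ℕ) / n, Nat.lt_succ_of_le ((Nat.sub_le _ _).trans (Nat.sub_le d 1))⟩ ⟨i, hi⟩ ⟨(j : ℕ) % n, Nat.mod_lt _ hn⟩
    else 0
  else if (j : ℕ) = (i : ℕ) - m then -1 else 0

/-- The first Frobenius companion form `C¹_P` of a matrix polynomial. -/
noncomputable def comp (m n d : ℕ) (P : Pol d m n) : Pencil (m + n*(d-1)) (n*d) :=
  (compA m n d P, compB m n d P)

/-- Strict equivalence of matrix pencils: `Q⁻¹ (λA+B) R = λC+D` for invertible `Q, R`. -/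
def StrictEquiv {p q : ℕ} (L M : Pencil p q) : Prop :=
  ∃ (Q : Matrix (Fin p) (Fin p) ℂ) (R : Matrix (Fin q) (Fin q) ℂ),
    IsUnit Q ∧ IsUnit R ∧ Q⁻¹ * L.1 * R = M.1 ∧ Q⁻¹ * L.2 * R = M.2

/-- The strict equivalence orbit of a pencil. -/
def orbE {p q : ℕ} (L : Pencil p q) : Set (Pencil p q) := {M | StrictEquiv L M}

/-- The generalized Sylvester space `GSYL¹_{d,m×n}` of all first companion forms. -/
def GSYL (m n d : ℕ) : Set (Pencil (m + n*(d-1)) (n*d)) := Set.range (comp m n d)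

/-- A matrix polynomial viewed as a matrix over the field `ℂ(λ)` of rational functions. -/
noncomputable def ratMatrix {m n d : ℕ} (P : Pol d m n) :
    Matrix (Fin m) (Fin n) (RatFunc ℂ) :=
  fun i j => ∑ k : Fin (d+1), RatFunc.C (P k i j) * RatFunc.X ^ (k : ℕ)

/-- The normal rank of a matrix polynomial: its rank over `ℂ(λ)`. -/
noncomputable def nrank {m n d : ℕ} (P : Pol d m n) : ℕ := (ratMatrix P).rank

/-- Offset of the `b`-th diagonal block when block `j` has size `sz j`. -/
def off (sz : ℕ → ℕ) (b : ℕ) : ℕ := ∑ j ∈ Finset.range b, sz j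

/-- The `p × q` matrix given as a direct sum of `N` diagonal blocks, where block `b`
has size `ρ b × γ b` and entries `ent b`, blocks being laid out along the diagonal
in order (block `b` occupies rows `[off ρ b, off ρ b + ρ b)` and columns
`[off γ b, off γ b + γ b)`); all other entries are zero. -/
noncomputable def dsum (N : ℕ) (ρ γ : ℕ → ℕ) (ent : ℕ → ℕ → ℕ → ℂ) (p q : ℕ) :
    Matrix (Fin p) (Fin q) ℂ := fun x y =>
  ∑ b ∈ Finset.range N,
    if off ρ b ≤ (x:ℕ) ∧ (x:ℕ) < off ρ b + ρ b ∧ off γ b ≤ (y:ℕ) ∧ (y:ℕ) < off γ b + γ b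
    then ent b ((x:ℕ) - off ρ b) ((y:ℕ) - off γ b) else 0

/-- Sizes of the four sections of blocks: `c₁` blocks of size `v₁`, then `c₂` of size
`v₂`, then `c₃` of size `v₃`, then the rest of size `v₄`. -/
def secSize (c₁ c₂ c₃ : ℕ) (v₁ v₂ v₃ v₄ : ℕ) (i : ℕ) : ℕ :=
  if i < c₁ then v₁ else if i < c₁ + c₂ then v₂ else if i < c₁ + c₂ + c₃ then v₃ else v₄

/-- The `p × q` pencil which is the direct sum of `c₁` copies of `L_{e₁}`, `c₂` copies
of `L_{e₂}`, `c₃` copies of `L_{f₁}ᵀ` and `c₄` copies of `L_{f₂}ᵀ`.  Here `L_k` is the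
`k × (k+1)` pencil `λ G_k + F_k` with `G_k` having ones in entries `(i,i)` and `F_k`
having ones in entries `(i,i+1)`. -/
noncomputable def genPencil (c₁ c₂ c₃ c₄ e₁ e₂ f₁ f₂ p q : ℕ) : Pencil p q :=
  (dsum (c₁+c₂+c₃+c₄) (secSize c₁ c₂ c₃ e₁ e₂ (f₁+1) (f₂+1))
     (secSize c₁ c₂ c₃ (e₁+1) (e₂+1) f₁ f₂)
     (fun _ i j => if i = j then 1 else 0) p q,
   dsum (c₁+c₂+c₃+c₄) (secSize c₁ c₂ c₃ e₁ e₂ (f₁+1) (f₂+1))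
     (secSize c₁ c₂ c₃ (e₁+1) (e₂+1) f₁ f₂)
     (fun b i j => if b < c₁ + c₂ then (if j = i+1 then 1 else 0)
       else (if i = j+1 then 1 else 0)) p q)

/-- The generic pencil `G_a` of Theorem 3.2 (viewed at grade `d`):  the direct sum of
`s` copies of `L_{α+d}`, `n−r−s` copies of `L_{α+d−1}`, `t` copies of `L_{β+1}ᵀ` and
`m−r−t` copies of `L_βᵀ`, where `α = ⌊a/(n−r)⌋`, `s = a mod (n−r)`,
`β = ⌊(rd−a)/(m−r)⌋`, `t = (rd−a) mod (m−r)`. -/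
noncomputable def Ga (m n d r a : ℕ) : Pencil (m + n*(d-1)) (n*d) :=
  genPencil (a % (n-r)) (n-r - a % (n-r)) ((r*d - a) % (m-r)) (m-r - (r*d - a) % (m-r))
    (a/(n-r) + d) (a/(n-r) + d - 1) ((r*d - a)/(m-r) + 1) ((r*d - a)/(m-r))
    (m + n*(d-1)) (n*d)


/-- The generic rank-`ρ` pencil of size `p × q` with parameter `b` (Theorem 3.2 of
De Terán–Dopico): direct sum of `s₁` copies of `L_{α₁+1}`, `q−ρ−s₁` copies of `L_{α₁}`,
`t₁` copies of `L_{β₁+1}ᵀ` and `p−ρ−t₁` copies of `L_{β₁}ᵀ`, where `α₁ = ⌊b/(q−ρ)⌋`,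
`s₁ = b mod (q−ρ)`, `β₁ = ⌊(ρ−b)/(p−ρ)⌋`, `t₁ = (ρ−b) mod (p−ρ)`. -/
noncomputable def Kp (p q ρ b : ℕ) : Pencil p q :=
  genPencil (b % (q-ρ)) (q-ρ - b % (q-ρ)) ((ρ-b) % (p-ρ)) (p-ρ - (ρ-b) % (p-ρ))
    (b/(q-ρ) + 1) (b/(q-ρ)) ((ρ-b)/(p-ρ) + 1) ((ρ-b)/(p-ρ)) p q

/-- The generic right-singular pencil `G_rp` (case `m < n`): direct sum of `s` copies of
`L_{α+d}` and `n−m−s` copies of `L_{α+d−1}`, with `α = ⌊md/(n−m)⌋`, `s = md mod (n−m)`. -/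
noncomputable def Grp (m n d : ℕ) : Pencil (m + n*(d-1)) (n*d) :=
  genPencil (m*d % (n-m)) (n-m - m*d % (n-m)) 0 0
    (m*d/(n-m) + d) (m*d/(n-m) + d - 1) 0 0 (m + n*(d-1)) (n*d)

/-- The generic left-singular pencil `G_ℓp` (case `m > n`): direct sum of `t` copies of
`L_{β+1}ᵀ` and `m−n−t` copies of `L_βᵀ`, with `β = ⌊nd/(m−n)⌋`, `t = nd mod (m−n)`. -/
noncomputable def Glp (m n d : ℕ) : Pencil (m + n*(d-1)) (n*d) :=
  genPencil 0 0 (n*d % (m-n)) (m-n - n*d % (m-n)) 0 0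
    (n*d/(m-n) + 1) (n*d/(m-n)) (m + n*(d-1)) (n*d)

/-- The linear map `(X, Y) ↦ (XA − AY, XB − BY)` whose range is the tangent space at
`λA+B` to the strict equivalence orbit of the pencil `λA+B`. -/
noncomputable def tangentMap {p q : ℕ} (L : Pencil p q) :
    (Matrix (Fin p) (Fin p) ℂ × Matrix (Fin q) (Fin q) ℂ) →ₗ[ℂ]
      (Matrix (Fin p) (Fin q) ℂ × Matrix (Fin p) (Fin q) ℂ) where
  toFun XY := (XY.1 * L.1 - L.1 * XY.2, XY.1 * L.2 - L.2 * XY.2)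
  map_add' X Y := by
    obtain ⟨X₁, X₂⟩ := X; obtain ⟨Y₁, Y₂⟩ := Y
    simp only [Prod.mk_add_mk, Matrix.add_mul, Matrix.mul_add, Prod.mk.injEq]
    constructor <;> abel
  map_smul' c X := by
    obtain ⟨X₁, X₂⟩ := X
    simp only [Prod.smul_mk, Matrix.smul_mul, Matrix.mul_smul, RingHom.id_apply,
      Prod.mk.injEq, smul_sub]

/-- The tangent space `T = {(XA − AY, XB − BY)}` at `λA+B` to its strict equivalence
orbit, as a subspace of the pencil space. -/
noncomputable def tangent {p q : ℕ} (L : Pencil p q) :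
    Submodule ℂ (Matrix (Fin p) (Fin q) ℂ × Matrix (Fin p) (Fin q) ℂ) :=
  LinearMap.range (tangentMap L)

/-- The first companion form `C¹_M(λ) = λ A + B` regarded as a matrix over `ℂ[λ]`. -/
noncomputable def compPoly (m n d : ℕ) (M : Pol d m n) :
    Matrix (Fin (m + n*(d-1))) (Fin (n*d)) (Polynomial ℂ) := fun i j =>
  Polynomial.C (compA m n d M i j) * Polynomial.X + Polynomial.C (compB m n d M i j)

/-- The block-diagonal matrix `diag(M(λ), I_{n(d−1)})` over `ℂ[λ]`. -/
noncomputable def polyBlock (m n d : ℕ) (M : Pol d m n) :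
    Matrix (Fin (m + n*(d-1))) (Fin (n*d)) (Polynomial ℂ) := fun i j =>
  if hi : (i : ℕ) < m then
    if hj : (j : ℕ) < n then
      ∑ k : Fin (d+1), Polynomial.C (M k ⟨i, hi⟩ ⟨j, hj⟩) * Polynomial.X ^ (k : ℕ)
    else 0
  else if (i : ℕ) - m = (j : ℕ) - n ∧ n ≤ (j : ℕ) then 1 else 0

/-- The first companion form regarded as a matrix over the field `ℂ(λ)`. -/
noncomputable def compRat (m n d : ℕ) (M : Pol d m n) :
    Matrix (Fin (m + n*(d-1))) (Fin (n*d)) (RatFunc ℂ) := fun i j =>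
  RatFunc.C (compA m n d M i j) * RatFunc.X + RatFunc.C (compB m n d M i j)


section
set_option linter.all false
set_option maxHeartbeats 400000


/-- Isomorphism of pairs of linear maps (Kronecker modules). -/
def KIso {V U V' U' : Type} [AddCommGroup V] [Module ℂ V] [AddCommGroup U] [Module ℂ U]
    [AddCommGroup V'] [Module ℂ V'] [AddCommGroup U'] [Module ℂ U']
    (A B : V →ₗ[ℂ] U) (A' B' : V' →ₗ[ℂ] U') : Prop :=
  ∃ (eV : V ≃ₗ[ℂ] V') (eU : U ≃ₗ[ℂ] U'),
    (∀ v, eU (A v) = A' (eV v)) ∧ (∀ v, eU (B v) = B' (eV v))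

section iso
variable {V U V' U' V'' U'' : Type} [AddCommGroup V] [Module ℂ V] [AddCommGroup U] [Module ℂ U]
    [AddCommGroup V'] [Module ℂ V'] [AddCommGroup U'] [Module ℂ U']
    [AddCommGroup V''] [Module ℂ V''] [AddCommGroup U''] [Module ℂ U'']

theorem KIso.symm {A B : V →ₗ[ℂ] U} {A' B' : V' →ₗ[ℂ] U'} (h : KIso A B A' B') :
    KIso A' B' A B := by
  obtain ⟨eV, eU, hA, hB⟩ := h
  refine ⟨eV.symm, eU.symm, fun v => ?_, fun v => ?_⟩
  · rw [LinearEquiv.symm_apply_eq, hA]; simp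
  · rw [LinearEquiv.symm_apply_eq, hB]; simp

theorem KIso.trans {A B : V →ₗ[ℂ] U} {A' B' : V' →ₗ[ℂ] U'} {A'' B'' : V'' →ₗ[ℂ] U''}
    (h : KIso A B A' B') (h' : KIso A' B' A'' B'') : KIso A B A'' B'' := by
  obtain ⟨eV, eU, hA, hB⟩ := h
  obtain ⟨eV', eU', hA', hB'⟩ := h'
  refine ⟨eV.trans eV', eU.trans eU', fun v => ?_, fun v => ?_⟩
  · simp [hA, hA']
  · simp [hB, hB']
end iso

theorem kiso_of_strictEquiv {p q : ℕ} {A B C D : Matrix (Fin p) (Fin q) ℂ}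
    (h : ∃ (Q : Matrix (Fin p) (Fin p) ℂ) (R : Matrix (Fin q) (Fin q) ℂ),
    IsUnit Q ∧ IsUnit R ∧ Q⁻¹ * A * R = C ∧ Q⁻¹ * B * R = D) :
    KIso A.mulVecLin B.mulVecLin C.mulVecLin D.mulVecLin := by
  obtain ⟨Q, R, hQ, hR, hA, hB⟩ := h
  have hQ' : IsUnit Q.det := (Matrix.isUnit_iff_isUnit_det _).1 hQ
  have hR' : IsUnit R.det := (Matrix.isUnit_iff_isUnit_det _).1 hR
  refine KIso.symm ⟨LinearEquiv.ofLinearMap R.mulVecLin R⁻¹.mulVecLin ?_ ?_,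
    LinearEquiv.ofLinearMap Q.mulVecLin Q⁻¹.mulVecLin ?_ ?_, ?_, ?_⟩
  · rw [← Matrix.mulVecLin_mul, Matrix.mul_nonsing_inv _ hR', Matrix.mulVecLin_one]
  · rw [← Matrix.mulVecLin_mul, Matrix.nonsing_inv_mul _ hR', Matrix.mulVecLin_one]
  · rw [← Matrix.mulVecLin_mul, Matrix.mul_nonsing_inv _ hQ', Matrix.mulVecLin_one]
  · rw [← Matrix.mulVecLin_mul, Matrix.nonsing_inv_mul _ hQ', Matrix.mulVecLin_one]
  · intro v
    simp only [LinearEquiv.coe_ofLinearMap, Matrix.mulVecLin_apply, Matrix.mulVec_mulVec]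
    rw [← hA, Matrix.mul_assoc, Matrix.mul_nonsing_inv_cancel_left _ _ hQ']
  · intro v
    simp only [LinearEquiv.coe_ofLinearMap, Matrix.mulVecLin_apply, Matrix.mulVec_mulVec]
    rw [← hB, Matrix.mul_assoc, Matrix.mul_nonsing_inv_cancel_left _ _ hQ']

theorem strictEquiv_of_kiso {p q : ℕ} {A B C D : Matrix (Fin p) (Fin q) ℂ}
    (h : KIso A.mulVecLin B.mulVecLin C.mulVecLin D.mulVecLin) :
    ∃ (Q : Matrix (Fin p) (Fin p) ℂ) (R : Matrix (Fin q) (Fin q) ℂ),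
    IsUnit Q ∧ IsUnit R ∧ Q⁻¹ * A * R = C ∧ Q⁻¹ * B * R = D := by
  obtain ⟨eV, eU, hA, hB⟩ := h.symm
  have hQ : IsUnit (LinearMap.toMatrix' (eU : (Fin p → ℂ) →ₗ[ℂ] (Fin p → ℂ))) := by
    rw [Matrix.isUnit_iff_isUnit_det, LinearMap.det_toMatrix']
    exact LinearEquiv.isUnit_det' eU
  have hR : IsUnit (LinearMap.toMatrix' (eV : (Fin q → ℂ) →ₗ[ℂ] (Fin q → ℂ))) := by
    rw [Matrix.isUnit_iff_isUnit_det, LinearMap.det_toMatrix']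
    exact LinearEquiv.isUnit_det' eV
  have key : ∀ (A C : Matrix (Fin p) (Fin q) ℂ), (∀ v, eU (C.mulVecLin v) = A.mulVecLin (eV v)) →
     (LinearMap.toMatrix' (eU : (Fin p → ℂ) →ₗ[ℂ] (Fin p → ℂ)))⁻¹ * A *
      (LinearMap.toMatrix' (eV : (Fin q → ℂ) →ₗ[ℂ] (Fin q → ℂ))) = C := by
    intro A C h
    have : A * (LinearMap.toMatrix' (eV : (Fin q → ℂ) →ₗ[ℂ] (Fin q → ℂ))) =
      (LinearMap.toMatrix' (eU : (Fin p → ℂ) →ₗ[ℂ] (Fin p → ℂ))) * C := by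
      apply Matrix.mulVec_injective
      funext v
      rw [← Matrix.mulVec_mulVec, ← Matrix.mulVec_mulVec, LinearMap.toMatrix'_mulVec,
        LinearMap.toMatrix'_mulVec]
      exact (h v).symm
    rw [Matrix.mul_assoc, this, Matrix.nonsing_inv_mul_cancel_left _ _
      ((Matrix.isUnit_iff_isUnit_det _).1 hQ)]
  exact ⟨_, _, hQ, hR, key _ _ hA, key _ _ hB⟩

section detect
variable {V U V₁ U₁ V₂ U₂ : Type} [AddCommGroup V] [Module ℂ V] [AddCommGroup U] [Module ℂ U]
    [AddCommGroup V₁] [Module ℂ V₁] [AddCommGroup U₁] [Module ℂ U₁]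
    [AddCommGroup V₂] [Module ℂ V₂] [AddCommGroup U₂] [Module ℂ U₂]
    [FiniteDimensional ℂ V] [FiniteDimensional ℂ U]
    [FiniteDimensional ℂ V₁] [FiniteDimensional ℂ U₁]
    [FiniteDimensional ℂ V₂] [FiniteDimensional ℂ U₂]

theorem ker_le_range_of_finrank (i : V₁ →ₗ[ℂ] V) (π : V →ₗ[ℂ] V₂)
    (hi : Function.Injective i) (hπ : Function.Surjective π) (h0 : ∀ v, π (i v) = 0)
    (hd : Module.finrank ℂ V = Module.finrank ℂ V₁ + Module.finrank ℂ V₂) :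
    LinearMap.range i = LinearMap.ker π := by
  apply Submodule.eq_of_le_of_finrank_eq
  · rintro _ ⟨v, rfl⟩; exact h0 v
  · have h1 := LinearMap.finrank_range_add_finrank_ker π
    rw [LinearMap.range_eq_top.2 hπ, finrank_top] at h1
    rw [LinearMap.finrank_range_of_inj hi]
    omega

/-- Detection of a direct sum decomposition. -/
theorem kiso_of_exact (A B : V →ₗ[ℂ] U) (A₁ B₁ : V₁ →ₗ[ℂ] U₁) (A₂ B₂ : V₂ →ₗ[ℂ] U₂)
    (iV : V₁ →ₗ[ℂ] V) (iU : U₁ →ₗ[ℂ] U) (πV : V →ₗ[ℂ] V₂) (πU : U →ₗ[ℂ] U₂)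
    (hiV : Function.Injective iV) (hiU : Function.Injective iU)
    (hπV : Function.Surjective πV) (hπU : Function.Surjective πU)
    (hV0 : ∀ v, πV (iV v) = 0)
    (hdV : Module.finrank ℂ V = Module.finrank ℂ V₁ + Module.finrank ℂ V₂)
    (hdU : Module.finrank ℂ U = Module.finrank ℂ U₁ + Module.finrank ℂ U₂)
    (hA1 : ∀ v, A (iV v) = iU (A₁ v)) (hB1 : ∀ v, B (iV v) = iU (B₁ v))
    (hA2 : ∀ v, πU (A v) = A₂ (πV v)) (hB2 : ∀ v, πU (B v) = B₂ (πV v))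
    (hsurj : Function.Surjective A₁)
    (hsplit : ∀ (ZA ZB : V₂ →ₗ[ℂ] U₁), ∃ (X : V₂ →ₗ[ℂ] V₁) (Y : U₂ →ₗ[ℂ] U₁),
      (∀ v, A₁ (X v) - Y (A₂ v) = ZA v) ∧ (∀ v, B₁ (X v) - Y (B₂ v) = ZB v)) :
    KIso A B (A₁.prodMap A₂) (B₁.prodMap B₂) := by
  have hU0 : ∀ u, πU (iU u) = 0 := by
    intro u
    obtain ⟨v, rfl⟩ := hsurj u
    rw [← hA1, hA2, hV0, map_zero]
  have hkU := ker_le_range_of_finrank iU πU hiU hπU hU0 hdU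
  obtain ⟨sV, hsV⟩ := πV.exists_rightInverse_of_surjective (LinearMap.range_eq_top.2 hπV)
  obtain ⟨sU, hsU⟩ := πU.exists_rightInverse_of_surjective (LinearMap.range_eq_top.2 hπU)
  have hsV' : ∀ v, πV (sV v) = v := fun v => LinearMap.congr_fun hsV v
  have hsU' : ∀ v, πU (sU v) = v := fun v => LinearMap.congr_fun hsU v
  obtain ⟨ρ, hρ⟩ := iU.exists_leftInverse_of_injective (LinearMap.ker_eq_bot.2 hiU)
  have hρ' : ∀ u, ρ (iU u) = u := fun v => LinearMap.congr_fun hρ v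
  have hρ'' : ∀ u, πU u = 0 → iU (ρ u) = u := by
    intro u hu
    have : u ∈ LinearMap.range iU := by rw [hkU]; exact hu
    obtain ⟨w, rfl⟩ := this
    rw [hρ']
  obtain ⟨X, Y, hX, hY⟩ := hsplit (ρ ∘ₗ (A ∘ₗ sV - sU ∘ₗ A₂)) (ρ ∘ₗ (B ∘ₗ sV - sU ∘ₗ B₂))
  have eA : ∀ v, A (sV v) - sU (A₂ v) = iU (A₁ (X v) - Y (A₂ v)) := by
    intro v; rw [hX]
    exact (hρ'' _ (by simp [hA2, hsV', hsU'])).symm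
  have eB : ∀ v, B (sV v) - sU (B₂ v) = iU (B₁ (X v) - Y (B₂ v)) := by
    intro v; rw [hY]
    exact (hρ'' _ (by simp [hB2, hsV', hsU'])).symm
  let FV : (V₁ × V₂) →ₗ[ℂ] V := LinearMap.coprod iV (sV - iV ∘ₗ X)
  let FU : (U₁ × U₂) →ₗ[ℂ] U := LinearMap.coprod iU (sU - iU ∘ₗ Y)
  have hFV : Function.Injective FV := by
    rw [← LinearMap.ker_eq_bot, LinearMap.ker_eq_bot']
    rintro ⟨v1, v2⟩ h
    have h2 : v2 = 0 := by
      have := congrArg πV h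
      simpa [FV, hV0, hsV'] using this
    subst h2
    have : iV v1 = 0 := by simpa [FV] using h
    rw [(map_eq_zero_iff _ hiV).1 this]; rfl
  have hFU : Function.Injective FU := by
    rw [← LinearMap.ker_eq_bot, LinearMap.ker_eq_bot']
    rintro ⟨v1, v2⟩ h
    have h2 : v2 = 0 := by
      have := congrArg πU h
      simpa [FU, hU0, hsU'] using this
    subst h2
    have : iU v1 = 0 := by simpa [FU] using h
    rw [(map_eq_zero_iff _ hiU).1 this]; rfl
  refine KIso.symm ⟨LinearEquiv.ofInjectiveOfFinrankEq FV hFV (by rw [hdV, Module.finrank_prod]),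
    LinearEquiv.ofInjectiveOfFinrankEq FU hFU (by rw [hdU, Module.finrank_prod]), ?_, ?_⟩
  · rintro ⟨v1, v2⟩
    have := eA v2
    rw [map_sub, sub_eq_iff_eq_add] at this
    change iU (A₁ v1) + (sU (A₂ v2) - iU (Y (A₂ v2))) = A (iV v1 + (sV v2 - iV (X v2)))
    rw [map_add, map_sub, hA1, hA1, this]
    abel
  · rintro ⟨v1, v2⟩
    have := eB v2
    rw [map_sub, sub_eq_iff_eq_add] at this
    change iU (B₁ v1) + (sU (B₂ v2) - iU (Y (B₂ v2))) = B (iV v1 + (sV v2 - iV (X v2)))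
    rw [map_add, map_sub, hB1, hB1, this]
    abel
end detect



/-- Extension by zero. -/
noncomputable def zext {n : ℕ} (u : Fin n → ℂ) (k : ℕ) : ℂ := if h : k < n then u ⟨k, h⟩ else 0

theorem zext_of_lt {n : ℕ} (u : Fin n → ℂ) {k : ℕ} (h : k < n) : zext u k = u ⟨k, h⟩ := dif_pos h
theorem zext_of_ge {n : ℕ} (u : Fin n → ℂ) {k : ℕ} (h : n ≤ k) : zext u k = 0 :=
  dif_neg (by omega)
@[simp] theorem zext_fin {n : ℕ} (u : Fin n → ℂ) (k : Fin n) : zext u k = u k := dif_pos k.2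
@[simp] theorem zext_add {n : ℕ} (u v : Fin n → ℂ) (k : ℕ) :
    zext (u + v) k = zext u k + zext v k := by unfold zext; split_ifs <;> simp
@[simp] theorem zext_smul {n : ℕ} (c : ℂ) (v : Fin n → ℂ) (k : ℕ) :
    zext (c • v) k = c * zext v k := by unfold zext; split_ifs <;> simp
@[simp] theorem zext_zero {n : ℕ} (k : ℕ) :
    zext (0 : Fin n → ℂ) k = 0 := by unfold zext; split_ifs <;> simp

abbrev MV {N : ℕ} (E : Fin N → ℕ) := ∀ j, Fin (E j + 1) → ℂ
abbrev MU {N : ℕ} (E : Fin N → ℕ) := ∀ j, Fin (E j) → ℂ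

noncomputable def mA1 {N : ℕ} (E : Fin N → ℕ) : MV E →ₗ[ℂ] MU E where
  toFun u j k := zext (u j) k
  map_add' u v := by ext j k; simp
  map_smul' c v := by ext j k; simp

noncomputable def mB1 {N : ℕ} (E : Fin N → ℕ) : MV E →ₗ[ℂ] MU E where
  toFun u j k := - zext (u j) (k + 1)
  map_add' u v := by ext j k; simp; ring
  map_smul' c v := by ext j k; simp

noncomputable def mA2 {N : ℕ} (E : Fin N → ℕ) : MU E →ₗ[ℂ] MV E where
  toFun u j k := zext (u j) k
  map_add' u v := by ext j k; simp
  map_smul' c v := by ext j k; simp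

noncomputable def mB2 {N : ℕ} (E : Fin N → ℕ) : MU E →ₗ[ℂ] MV E where
  toFun u j k := if (k : ℕ) = 0 then 0 else - zext (u j) (k - 1)
  map_add' u v := by ext j k; simp; split_ifs <;> ring
  map_smul' c v := by ext j k; simp

theorem mA1_surj {N : ℕ} (E : Fin N → ℕ) : Function.Surjective (mA1 E) := by
  intro z
  refine ⟨fun j k => zext (z j) k, ?_⟩
  ext j k
  change zext (fun k : Fin (E j + 1) => zext (z j) k) k = _
  rw [zext_of_lt _ (by omega)]
  simp

section split
variable {V₁ U₁ : Type} [AddCommGroup V₁] [Module ℂ V₁] [AddCommGroup U₁] [Module ℂ U₁]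

/-- auxiliary recursion for `y` -/
noncomputable def splitY (s : U₁ → V₁) (B₁ : V₁ → U₁) (zA zB : ℕ → U₁) : ℕ → U₁
  | 0 => 0
  | k + 1 => -(B₁ (s (zA k + splitY s B₁ zA zB k)) - zB k)

theorem model_split (A₁ B₁ : V₁ →ₗ[ℂ] U₁) (hA : Function.Surjective A₁) {M : ℕ} (H : Fin M → ℕ)
    (ZA ZB : MU H →ₗ[ℂ] U₁) : ∃ (X : MU H →ₗ[ℂ] V₁) (Y : MV H →ₗ[ℂ] U₁),
      (∀ v, A₁ (X v) - Y (mA2 H v) = ZA v) ∧ (∀ v, B₁ (X v) - Y (mB2 H v) = ZB v) := by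
  classical
  choose s hs using hA
  let zA : Fin M → ℕ → U₁ := fun j k =>
    if h : k < H j then ZA (Pi.single j (Pi.single (⟨k, h⟩ : Fin (H j)) (1 : ℂ))) else 0
  let zB : Fin M → ℕ → U₁ := fun j k =>
    if h : k < H j then ZB (Pi.single j (Pi.single (⟨k, h⟩ : Fin (H j)) (1 : ℂ))) else 0
  let y : Fin M → ℕ → U₁ := fun j => splitY s B₁ (zA j) (zB j)
  let x : Fin M → ℕ → V₁ := fun j k => s (zA j k + y j k)
  have hy0 : ∀ j, y j 0 = 0 := fun j => rfl
  have hy : ∀ j k, y j (k + 1) = -(B₁ (x j k) - zB j k) := fun j k => rfl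
  have hx : ∀ j k, A₁ (x j k) = zA j k + y j k := fun j k => hs _
  have hdec : ∀ (Z : MU H →ₗ[ℂ] U₁) (v : MU H), Z v = ∑ j, ∑ k : Fin (H j), v j k •
      Z (Pi.single j (Pi.single k (1 : ℂ))) := by
    intro Z v
    conv_lhs => rw [← Finset.univ_sum_single v]
    rw [map_sum]
    refine Finset.sum_congr rfl fun j _ => ?_
    have : (Pi.single j (v j) : MU H) = ∑ k : Fin (H j), v j k •
        (Pi.single j (Pi.single k (1 : ℂ)) : MU H) := by
      conv_lhs => rw [← Finset.univ_sum_single (v j)]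
      ext i l
      by_cases h : i = j
      · subst h
        simp [Finset.sum_apply, Pi.single_apply]
      · simp [Finset.sum_apply, h]
    rw [this, map_sum]
    simp
  refine ⟨∑ j, ∑ k : Fin (H j), (((LinearMap.proj k : (Fin (H j) → ℂ) →ₗ[ℂ] ℂ).comp
      (LinearMap.proj j : MU H →ₗ[ℂ] (Fin (H j) → ℂ))) : MU H →ₗ[ℂ] ℂ).smulRight (x j k), ∑ j, ∑ k : Fin (H j + 1),
      (((LinearMap.proj k : (Fin (H j + 1) → ℂ) →ₗ[ℂ] ℂ).comp
      (LinearMap.proj j : MV H →ₗ[ℂ] (Fin (H j + 1) → ℂ))) : MV H →ₗ[ℂ] ℂ).smulRight (y j k), fun v => ?_, fun v => ?_⟩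
  · rw [hdec ZA v]
    simp only [LinearMap.sum_apply, LinearMap.smulRight_apply, LinearMap.comp_apply,
      LinearMap.proj_apply, map_sum, map_smul]
    rw [← Finset.sum_sub_distrib]
    refine Finset.sum_congr rfl fun j _ => ?_
    rw [Fin.sum_univ_castSucc]
    have h1 : mA2 H v j (Fin.last (H j)) = 0 := by
      change zext (v j) _ = 0
      exact zext_of_ge _ (by simp)
    rw [h1, zero_smul, add_zero, ← Finset.sum_sub_distrib]
    refine Finset.sum_congr rfl fun k _ => ?_
    have h2 : mA2 H v j k.castSucc = v j k := by
      change zext (v j) _ = _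
      simp
    rw [h2, ← smul_sub, hx]
    have h3 : zA j k = ZA (Pi.single j (Pi.single k (1 : ℂ))) := by simp [zA]
    rw [h3]; simp
  · rw [hdec ZB v]
    simp only [LinearMap.sum_apply, LinearMap.smulRight_apply, LinearMap.comp_apply,
      LinearMap.proj_apply, map_sum, map_smul]
    rw [← Finset.sum_sub_distrib]
    refine Finset.sum_congr rfl fun j _ => ?_
    rw [Fin.sum_univ_succ]
    have h1 : mB2 H v j 0 = 0 := by
      change (if ((0 : Fin (H j + 1)) : ℕ) = 0 then (0:ℂ) else
        -zext (v j) (((0 : Fin (H j + 1)) : ℕ) - 1)) = _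
      exact if_pos rfl
    rw [h1, zero_smul, zero_add, ← Finset.sum_sub_distrib]
    refine Finset.sum_congr rfl fun k _ => ?_
    have h2 : mB2 H v j k.succ = - v j k := by
      change (if (k.succ : ℕ) = 0 then (0:ℂ) else -zext (v j) ((k.succ : ℕ) - 1)) = _
      rw [if_neg (by simp), zext_of_lt _ (by simp)]
      congr 1
    have h3 : zB j k = ZB (Pi.single j (Pi.single k (1 : ℂ))) := by simp [zB]
    rw [h2, Fin.val_succ, hy, h3]
    module
end split

/-! ### Toeplitz kernels -/
section toep
variable {V U V' U' : Type} [AddCommGroup V] [Module ℂ V] [AddCommGroup U] [Module ℂ U]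
    [AddCommGroup V'] [Module ℂ V'] [AddCommGroup U'] [Module ℂ U']

def Phi2 (A B : V →ₗ[ℂ] U) (K : ℕ) : (Fin (K + 1) → V) →ₗ[ℂ] (Fin K → U) where
  toFun x t := A (x t.castSucc) + B (x t.succ)
  map_add' u v := by ext t; simp; abel
  map_smul' c v := by ext t; simp

def Phi1 (A B : V →ₗ[ℂ] U) (K : ℕ) : (Fin (K + 1) → V) →ₗ[ℂ] (Fin K → U) × U × U :=
  (Phi2 A B K).prod ((B.comp (LinearMap.proj 0)).prod (A.comp (LinearMap.proj (Fin.last K))))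

theorem mem_ker_phi1_iff (A B : V →ₗ[ℂ] U) (K : ℕ) (x : Fin (K + 1) → V) :
    x ∈ LinearMap.ker (Phi1 A B K) ↔
      Phi2 A B K x = 0 ∧ B (x 0) = 0 ∧ A (x (Fin.last K)) = 0 := by
  rw [LinearMap.mem_ker]
  change ((Phi2 A B K x, B (x 0), A (x (Fin.last K))) : (Fin K → U) × U × U) = 0 ↔ _
  rw [Prod.mk_eq_zero, Prod.mk_eq_zero]

theorem finrank_ker_phi2 {A B : V →ₗ[ℂ] U} {A' B' : V' →ₗ[ℂ] U'} (h : KIso A B A' B') (K : ℕ) :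
    Module.finrank ℂ (LinearMap.ker (Phi2 A B K)) =
      Module.finrank ℂ (LinearMap.ker (Phi2 A' B' K)) := by
  obtain ⟨eV, eU, hA, hB⟩ := h
  let e : (Fin (K + 1) → V) ≃ₗ[ℂ] (Fin (K + 1) → V') := LinearEquiv.piCongrRight fun _ => eV
  have : (LinearMap.ker (Phi2 A B K)).map (e : (Fin (K + 1) → V) →ₗ[ℂ] (Fin (K + 1) → V')) =
      LinearMap.ker (Phi2 A' B' K) := by
    ext x
    rw [Submodule.mem_map_equiv]
    simp only [LinearMap.mem_ker, funext_iff]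
    refine forall_congr' fun t => ?_
    have : eU (Phi2 A B K (e.symm x) t) = Phi2 A' B' K x t := by
      simp [Phi2, hA, hB, e]
    rw [← this]; simp
  rw [← this, LinearEquiv.finrank_map_eq]

theorem finrank_ker_phi1 {A B : V →ₗ[ℂ] U} {A' B' : V' →ₗ[ℂ] U'} (h : KIso A B A' B') (K : ℕ) :
    Module.finrank ℂ (LinearMap.ker (Phi1 A B K)) =
      Module.finrank ℂ (LinearMap.ker (Phi1 A' B' K)) := by
  obtain ⟨eV, eU, hA, hB⟩ := h
  let e : (Fin (K + 1) → V) ≃ₗ[ℂ] (Fin (K + 1) → V') := LinearEquiv.piCongrRight fun _ => eV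
  have : (LinearMap.ker (Phi1 A B K)).map (e : (Fin (K + 1) → V) →ₗ[ℂ] (Fin (K + 1) → V')) =
      LinearMap.ker (Phi1 A' B' K) := by
    ext x
    rw [Submodule.mem_map_equiv]
    rw [mem_ker_phi1_iff, mem_ker_phi1_iff]
    refine and_congr ?_ (and_congr ?_ ?_)
    · simp only [funext_iff]
      refine forall_congr' fun t => ?_
      have : eU (Phi2 A B K (e.symm x) t) = Phi2 A' B' K x t := by
        simp [Phi2, hA, hB, e]
      rw [← this]; simp
    · rw [← map_eq_zero_iff eU eU.injective]; simp [hB, e]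
    · rw [← map_eq_zero_iff eU eU.injective]; simp [hA, e]
  rw [← this, LinearEquiv.finrank_map_eq]
end toep

section modelker
variable {N M : ℕ} (E : Fin N → ℕ) (H : Fin M → ℕ) (K : ℕ)

/-- coordinates of a sequence -/
noncomputable def sx {N : ℕ} {E : Fin N → ℕ} {K : ℕ} (x : Fin (K + 1) → (∀ j, Fin (E j) → ℂ))
    (j : Fin N) (t k : ℕ) : ℂ := if h : t < K + 1 then zext (x ⟨t, h⟩ j) k else 0

theorem sx_ext {x y : Fin (K + 1) → (∀ j, Fin (E j) → ℂ)}
    (h : ∀ j t k, t < K + 1 → k < E j → sx x j t k = sx y j t k) : x = y := by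
  ext t j k
  have := h j t k t.2 k.2
  have ht := Nat.lt_succ_iff.1 t.2
  simpa [sx, ht] using this

theorem mem_ker_phi2 (x : Fin (K + 1) → MV E × MU H) :
    x ∈ LinearMap.ker (Phi2 ((mA1 E).prodMap (mA2 H)) ((mB1 E).prodMap (mB2 H)) K) ↔
    (∀ j t k, t < K → k < E j → sx (fun t => (x t).1) j t k = sx (fun t => (x t).1) j (t+1) (k+1)) ∧
    (∀ j t k, t < K → k < H j + 1 → sx (fun t => (x t).2) j t k =
      if k = 0 then 0 else sx (fun t => (x t).2) j (t+1) (k-1)) := by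
  rw [LinearMap.mem_ker]
  constructor
  · intro h
    constructor
    · intro j t k ht hk
      have := congrFun (congrFun (congrArg Prod.fst (congrFun h ⟨t, ht⟩)) j) ⟨k, hk⟩
      have h2 : zext ((x ⟨t, by omega⟩).1 j) k + - zext ((x ⟨t+1, by omega⟩).1 j) (k+1) = 0 := this
      simp only [sx, show t < K + 1 by omega, show t + 1 < K + 1 by omega, dif_pos]
      linear_combination h2
    · intro j t k ht hk
      have := congrFun (congrFun (congrArg Prod.snd (congrFun h ⟨t, ht⟩)) j) ⟨k, hk⟩
      have h2 : zext ((x ⟨t, by omega⟩).2 j) k + (if k = 0 then 0 else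
        - zext ((x ⟨t+1, by omega⟩).2 j) (k-1)) = 0 := this
      simp only [sx, show t < K + 1 by omega, show t + 1 < K + 1 by omega, dif_pos]
      split_ifs at h2 ⊢ <;> linear_combination h2
  · rintro ⟨h1, h2⟩
    funext t
    refine Prod.ext ?_ ?_
    · ext j k
      have := h1 j t k t.2 k.2
      simp only [sx, show (t:ℕ) < K + 1 by omega, show (t:ℕ) + 1 < K + 1 by omega, dif_pos] at this
      change zext ((x ⟨t, _⟩).1 j) k + - zext ((x ⟨t+1, _⟩).1 j) (k+1) = 0
      rw [this]; ring
    · ext j k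
      have := h2 j t k t.2 k.2
      simp only [sx, show (t:ℕ) < K + 1 by omega, show (t:ℕ) + 1 < K + 1 by omega, dif_pos] at this
      change zext ((x ⟨t, _⟩).2 j) k + (if (k:ℕ) = 0 then 0 else
        - zext ((x ⟨t+1, _⟩).2 j) (k-1)) = 0
      rw [this]; split_ifs <;> ring

theorem mem_ker_phi1 (x : Fin (K + 1) → MV E × MU H) :
    x ∈ LinearMap.ker (Phi1 ((mA1 E).prodMap (mA2 H)) ((mB1 E).prodMap (mB2 H)) K) ↔
    x ∈ LinearMap.ker (Phi2 ((mA1 E).prodMap (mA2 H)) ((mB1 E).prodMap (mB2 H)) K) ∧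
    (∀ j k, k < E j → sx (fun t => (x t).1) j 0 (k+1) = 0) ∧
    (∀ j k, k < E j → sx (fun t => (x t).1) j K k = 0) ∧
    (∀ j k, k < H j → sx (fun t => (x t).2) j 0 k = 0) ∧
    (∀ j k, k < H j → sx (fun t => (x t).2) j K k = 0) := by
  rw [mem_ker_phi1_iff]
  refine and_congr Iff.rfl ?_
  constructor
  · rintro ⟨h0, hK⟩
    refine ⟨fun j k hk => ?_, fun j k hk => ?_, fun j k hk => ?_, fun j k hk => ?_⟩
    · have : - zext ((x 0).1 j) (k+1) = 0 :=
        congrFun (congrFun (congrArg Prod.fst h0) j) ⟨k, hk⟩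
      simpa [sx] using this
    · have : zext ((x (Fin.last K)).1 j) k = 0 :=
        congrFun (congrFun (congrArg Prod.fst hK) j) ⟨k, hk⟩
      simp only [sx]; rw [dif_pos (by omega)]; exact this
    · have : (if k + 1 = 0 then 0 else - zext ((x 0).2 j) (k+1-1)) = 0 :=
        congrFun (congrFun (congrArg Prod.snd h0) j) ⟨k+1, by omega⟩
      simpa [sx] using this
    · have : zext ((x (Fin.last K)).2 j) k = 0 :=
        congrFun (congrFun (congrArg Prod.snd hK) j) ⟨k, by omega⟩
      simp only [sx]; rw [dif_pos (by omega)]; exact this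
  · rintro ⟨h1, h2, h3, h4⟩
    refine ⟨Prod.ext ?_ ?_, Prod.ext ?_ ?_⟩
    · ext j k
      have := h1 j k k.2
      simp [sx] at this
      change - zext ((x 0).1 j) (k+1) = 0
      simpa using this
    · ext j k
      change (if (k:ℕ) = 0 then 0 else - zext ((x 0).2 j) (k-1)) = 0
      split_ifs with hk
      · rfl
      · have := h3 j (k-1) (by omega)
        simp [sx] at this
        simpa using this
    · ext j k
      have := h2 j k k.2
      simp [sx] at this
      change zext ((x (Fin.last K)).1 j) k = 0
      exact (zext_of_lt _ (by omega)).trans ((zext_of_lt _ (by omega)).symm.trans this)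
    · ext j k
      change zext ((x (Fin.last K)).2 j) k = 0
      by_cases hk : (k:ℕ) < H j
      · have := h4 j k hk
        simp [sx] at this
        exact this
      · exact zext_of_ge _ (by omega)

theorem ker_snd_zero (hH : ∀ j, H j ≤ K) (x : Fin (K + 1) → MV E × MU H)
    (h : ∀ j t k, t < K → k < H j + 1 → sx (fun t => (x t).2) j t k =
      if k = 0 then 0 else sx (fun t => (x t).2) j (t+1) (k-1)) (t) : (x t).2 = 0 := by
  have hfw : ∀ j k t, t + k < K → k < H j + 1 → sx (fun t => (x t).2) j t k = 0 := by
    intro j k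
    induction k with
    | zero => intro t ht hk; rw [h j t 0 (by omega) hk]; simp
    | succ k ih =>
      intro t ht hk
      rw [h j t (k+1) (by omega) hk, if_neg (by omega)]
      exact ih (t+1) (by omega) (by omega)
  have hbw : ∀ j t k, t < K + 1 → H j ≤ t + k → sx (fun t => (x t).2) j t k = 0 := by
    intro j t
    induction t with
    | zero => intro k ht hk; simp only [sx]; rw [dif_pos (by omega)]; exact zext_of_ge _ (by omega)
    | succ t ih =>
      intro k ht hk
      by_cases hk' : k < H j
      · have := h j t (k+1) (by omega) (by omega)
        rw [if_neg (by omega)] at this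
        simp only [Nat.add_sub_cancel] at this
        rw [← this]
        exact ih (k+1) (by omega) (by omega)
      · simp only [sx]; rw [dif_pos (by omega)]; exact zext_of_ge _ (by omega)
  ext j k
  have : sx (fun t => (x t).2) j t k = 0 := by
    by_cases h1 : (t:ℕ) + k < K
    · exact hfw j k t h1 (by omega)
    · exact hbw j t k t.2 (by have := hH j; omega)
  have ht := Nat.lt_succ_iff.1 t.2
  simpa [sx, ht] using this

theorem ker_fst_shift {X : ℕ → ℕ → ℂ} {K e : ℕ}
    (h : ∀ t k, t < K → k < e → X t k = X (t+1) (k+1)) :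
    ∀ s t k, t + s ≤ K → k + s ≤ e → X t k = X (t+s) (k+s) := by
  intro s
  induction s with
  | zero => intros; rfl
  | succ s ih =>
    intro t k ht hk
    rw [ih t k (by omega) (by omega), h (t+s) (k+s) (by omega) (by omega)]
    rfl

noncomputable def F2 : (∀ j, Fin (E j + K + 1) → ℂ) →ₗ[ℂ] (Fin (K + 1) → MV E × MU H) where
  toFun z t := (fun j k => zext (z j) (k + K - t), 0)
  map_add' u v := by ext t j k <;> simp
  map_smul' c v := by ext t j k <;> simp

theorem sx_F2 (z) (j t k) (ht : t < K + 1) (hk : k < E j + 1) :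
    sx (fun t => (F2 E H K z t).1) j t k = zext (z j) (k + K - t) := by
  simp only [sx, ht, dif_pos]
  rw [zext_of_lt _ hk]; rfl

theorem finrank_ker2 (hH : ∀ j, H j ≤ K) :
    Module.finrank ℂ (LinearMap.ker (Phi2 ((mA1 E).prodMap (mA2 H)) ((mB1 E).prodMap (mB2 H)) K)) =
    ∑ j, (E j + K + 1) := by
  have hinj : Function.Injective (F2 E H K) := by
    intro z z' h
    ext j i
    by_cases hi : (i:ℕ) ≤ K
    · have := congrFun (congrFun (congrArg Prod.fst (congrFun h ⟨K - i, by omega⟩)) j) ⟨0, by omega⟩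
      have h2 : zext (z j) (0 + K - (K - i)) = zext (z' j) (0 + K - (K - i)) := this
      rw [show 0 + K - (K - i) = (i:ℕ) by omega] at h2
      simpa using h2
    · have := congrFun (congrFun (congrArg Prod.fst (congrFun h ⟨0, by omega⟩)) j) ⟨i - K, by omega⟩
      have h2 : zext (z j) ((i - K) + K - 0) = zext (z' j) ((i - K) + K - 0) := this
      rw [show (i - K) + K - 0 = (i:ℕ) by omega] at h2
      simpa using h2
  have hr : LinearMap.range (F2 E H K) =
      LinearMap.ker (Phi2 ((mA1 E).prodMap (mA2 H)) ((mB1 E).prodMap (mB2 H)) K) := by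
    apply le_antisymm
    · rintro _ ⟨z, rfl⟩
      rw [mem_ker_phi2]
      refine ⟨fun j t k ht hk => ?_, fun j t k ht hk => ?_⟩
      · rw [sx_F2 _ _ _ _ _ _ _ (by omega) (by omega), sx_F2 _ _ _ _ _ _ _ (by omega) (by omega)]
        congr 1; omega
      · have : ∀ t, (F2 E H K z t).2 = 0 := fun t => rfl
        simp [sx, this]
    · intro x hx
      rw [mem_ker_phi2] at hx
      have h2 := ker_snd_zero E H K hH x hx.2
      refine ⟨fun j i => if (i:ℕ) ≤ K then sx (fun t => (x t).1) j (K - i) 0 else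
        sx (fun t => (x t).1) j 0 (i - K), ?_⟩
      funext t
      refine Prod.ext ?_ (h2 t).symm
      revert t
      rw [← funext_iff (f := fun t => (F2 E H K _ t).1) (g := fun t => (x t).1)]
      apply sx_ext (fun j => E j + 1) K
      intro j t k ht hk
      rw [sx_F2 _ _ _ _ _ _ _ ht hk, zext_of_lt _ (by omega)]
      have hs := ker_fst_shift (hx.1 j)
      dsimp only
      split_ifs with hc
      · rw [hs k (K - (k + K - t)) 0 (by omega) (by omega)]
        congr 1 <;> omega
      · rw [hs t 0 _ (by omega) (by omega)]
        congr 1 <;> omega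
  rw [← hr, LinearMap.finrank_range_of_inj hinj, Module.finrank_pi_fintype]
  simp

noncomputable def F1 : (∀ j, Fin (K + 1 - E j) → ℂ) →ₗ[ℂ] (Fin (K + 1) → MV E × MU H) where
  toFun z t := (fun j k => if E j ≤ k + K - t then zext (z j) (k + K - t - E j) else 0, 0)
  map_add' u v := by ext t j k <;> simp; split_ifs <;> simp
  map_smul' c v := by ext t j k <;> simp

theorem sx_F1 (z) (j t k) (ht : t < K + 1) (hk : k < E j + 1) :
    sx (fun t => (F1 E H K z t).1) j t k =
      if E j ≤ k + K - t then zext (z j) (k + K - t - E j) else 0 := by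
  simp only [sx, ht, dif_pos]
  rw [zext_of_lt _ hk]; rfl

theorem finrank_ker1 (hH : ∀ j, H j ≤ K) (hE : ∀ j, E j ≤ K) :
    Module.finrank ℂ (LinearMap.ker (Phi1 ((mA1 E).prodMap (mA2 H)) ((mB1 E).prodMap (mB2 H)) K)) =
    ∑ j, (K + 1 - E j) := by
  have hinj : Function.Injective (F1 E H K) := by
    intro z z' h
    ext j i
    have hi := i.2
    have := congrFun (congrFun (congrArg Prod.fst (congrFun h ⟨K - E j - i, by omega⟩)) j) ⟨0, by omega⟩
    have h2 : (if E j ≤ 0 + K - (K - E j - i) then zext (z j) (0 + K - (K - E j - i) - E j) else 0)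
      = (if E j ≤ 0 + K - (K - E j - i) then zext (z' j) (0 + K - (K - E j - i) - E j) else 0) := this
    rw [if_pos (by omega), if_pos (by omega),
      show 0 + K - (K - E j - i) - E j = (i:ℕ) by have := hE j; omega] at h2
    simpa using h2
  have hr : LinearMap.range (F1 E H K) =
      LinearMap.ker (Phi1 ((mA1 E).prodMap (mA2 H)) ((mB1 E).prodMap (mB2 H)) K) := by
    apply le_antisymm
    · rintro _ ⟨z, rfl⟩
      have h0 : ∀ t, (F1 E H K z t).2 = 0 := fun t => rfl
      rw [mem_ker_phi1, mem_ker_phi2]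
      refine ⟨⟨fun j t k ht hk => ?_, fun j t k ht hk => ?_⟩, fun j k hk => ?_, fun j k hk => ?_,
        fun j k hk => ?_, fun j k hk => ?_⟩
      · rw [sx_F1 _ _ _ _ _ _ _ (by omega) (by omega), sx_F1 _ _ _ _ _ _ _ (by omega) (by omega)]
        rw [show k + 1 + K - (t + 1) = k + K - t by omega]
      · simp [sx, h0]
      · rw [sx_F1 _ _ _ _ _ _ _ (by omega) (by omega)]
        split_ifs
        · exact zext_of_ge _ (by omega)
        · rfl
      · rw [sx_F1 _ _ _ _ _ _ _ (by omega) (by omega), if_neg (by omega)]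
      · simp [sx, h0]
      · simp [sx, h0]
    · intro x hx
      rw [mem_ker_phi1, mem_ker_phi2] at hx
      obtain ⟨⟨hx1, hx2⟩, hb0, hbK, -, -⟩ := hx
      have h2 := ker_snd_zero E H K hH x hx2
      refine ⟨fun j i => sx (fun t => (x t).1) j (K - E j - i) 0, ?_⟩
      funext t
      refine Prod.ext ?_ (h2 t).symm
      revert t
      rw [← funext_iff (f := fun t => (F1 E H K _ t).1) (g := fun t => (x t).1)]
      apply sx_ext (fun j => E j + 1) K
      intro j t k ht hk
      have hEj := hE j
      rw [sx_F1 _ _ _ _ _ _ _ ht hk]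
      have hs := ker_fst_shift (hx1 j)
      split_ifs with hc
      · by_cases hkt : k ≤ t
        · rw [zext_of_lt _ (by omega), hs k _ 0 (by dsimp only; omega) (by omega)]
          have e1 : K - E j - (k + K - t - E j) + k = t := by omega
          have e2 : 0 + k = k := by omega
          dsimp only
          rw [e1, e2]
        · rw [zext_of_ge _ (by omega)]
          have h3 := hs t 0 (k - t) (by omega) (by omega)
          rw [show 0 + t = t by omega, show k - t + t = k by omega] at h3
          rw [← h3]
          have h4 := hb0 j (k - t - 1) (by omega)
          rw [show k - t - 1 + 1 = k - t by omega] at h4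
          exact h4.symm
      · rw [hs (K - t) t k (by omega) (by omega), show t + (K - t) = K by omega]
        exact (hbK j _ (by omega)).symm
  rw [← hr, LinearMap.finrank_range_of_inj hinj, Module.finrank_pi_fintype]
  simp
end modelker


/-! ### The generic pencil and the model -/
theorem off_succ (γ : ℕ → ℕ) (b : ℕ) : off γ (b+1) = off γ b + γ b := Finset.sum_range_succ _ _

theorem off_mono (γ : ℕ → ℕ) {b c : ℕ} (h : b ≤ c) : off γ b ≤ off γ c := by
  induction h with
  | refl => exact le_rfl
  | step _ ih => rw [Nat.succ_eq_add_one, off_succ]; omega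

theorem off_exists (γ : ℕ → ℕ) (L y : ℕ) (h : y < off γ L) :
    ∃ b < L, ∃ k < γ b, y = off γ b + k := by
  induction L with
  | zero => simp [off] at h
  | succ L ih =>
    by_cases hy : y < off γ L
    · obtain ⟨b, hb, k, hk, e⟩ := ih hy
      exact ⟨b, by omega, k, hk, e⟩
    · rw [off_succ] at h
      exact ⟨L, by omega, y - off γ L, by omega, by omega⟩

theorem dsum_mulVec (L : ℕ) (ρ γ : ℕ → ℕ) (ent : ℕ → ℕ → ℕ → ℂ) (p q : ℕ)
    (hq : q = off γ L) (v : Fin q → ℂ) (b i : ℕ) (hb : b < L) (hi : i < ρ b)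
    (x : Fin p) (hx : (x : ℕ) = off ρ b + i) :
    (dsum L ρ γ ent p q *ᵥ v) x = ∑ k ∈ range (γ b), ent b i k * zext v (off γ b + k) := by
  have h1 : ∀ y : Fin q, dsum L ρ γ ent p q x y =
      if off γ b ≤ (y:ℕ) ∧ (y:ℕ) < off γ b + γ b then ent b i ((y:ℕ) - off γ b) else 0 := by
    intro y
    unfold dsum
    rw [Finset.sum_eq_single b]
    · rw [hx]
      simp only [le_add_iff_nonneg_right, zero_le, true_and, add_lt_add_iff_left, hi,
        Nat.add_sub_cancel_left]
    · intro b' _ hne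
      rw [if_neg]
      rintro ⟨h1, h2, -⟩
      rcases lt_or_gt_of_ne hne with h | h
      · have := off_mono ρ (show b' + 1 ≤ b by omega)
        rw [off_succ] at this
        omega
      · have := off_mono ρ (show b + 1 ≤ b' by omega)
        rw [off_succ] at this
        omega
    · intro h; exact absurd (Finset.mem_range.2 hb) h
  have h2 : (dsum L ρ γ ent p q *ᵥ v) x = ∑ y ∈ range q,
      (if off γ b ≤ y ∧ y < off γ b + γ b then ent b i (y - off γ b) else 0) * zext v y := by
    rw [← Fin.sum_univ_eq_sum_range (fun y => (if off γ b ≤ y ∧ y < off γ b + γ b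
      then ent b i (y - off γ b) else 0) * zext v y)]
    simp only [Matrix.mulVec, dotProduct, h1, zext_fin]
  rw [h2]
  have hle : off γ b + γ b ≤ q := by
    rw [hq, ← off_succ]; exact off_mono _ hb
  have : ∑ k ∈ range (γ b), ent b i k * zext v (off γ b + k) =
      ∑ y ∈ Ico (off γ b) (off γ b + γ b), ent b i (y - off γ b) * zext v y := by
    rw [Finset.sum_Ico_eq_sum_range]
    simp
  rw [this]
  simp only [ite_mul, zero_mul]
  rw [← Finset.sum_filter]
  refine Finset.sum_congr ?_ fun _ _ => rfl
  ext y
  simp only [mem_filter, mem_range, mem_Ico]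
  omega

theorem finrank_MU {N : ℕ} (E : Fin N → ℕ) : Module.finrank ℂ (MU E) = ∑ j, E j := by
  rw [Module.finrank_pi_fintype]; simp

theorem finrank_MV {N : ℕ} (E : Fin N → ℕ) : Module.finrank ℂ (MV E) = ∑ j, (E j + 1) := by
  rw [Module.finrank_pi_fintype]; simp

section kd
variable {N M : ℕ} (E : Fin N → ℕ) (H : Fin M → ℕ)

noncomputable def blk (γ : ℕ → ℕ) (q : ℕ) (s t : Fin N → ℕ) :
    (Fin q → ℂ) →ₗ[ℂ] (∀ j, Fin (t j) → ℂ) where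
  toFun v j k := (-1) ^ (k:ℕ) * zext v (off γ (s j) + k)
  map_add' u v := by ext j k; simp; ring
  map_smul' c v := by ext j k; simp; ring

theorem kiso_dsum (ρ γ : ℕ → ℕ) (hρ1 : ∀ j : Fin N, ρ j = E j) (hγ1 : ∀ j : Fin N, γ j = E j + 1)
    (hρ2 : ∀ j : Fin M, ρ (N + j) = H j + 1) (hγ2 : ∀ j : Fin M, γ (N + j) = H j)
    (p q : ℕ) (hp : p = off ρ (N + M)) (hq : q = off γ (N + M)) :
    KIso (dsum (N + M) ρ γ (fun _ i j => if i = j then 1 else 0) p q).mulVecLin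
      (dsum (N + M) ρ γ (fun b i j => if b < N then (if j = i+1 then 1 else 0)
       else (if i = j+1 then 1 else 0)) p q).mulVecLin
      ((mA1 E).prodMap (mA2 H)) ((mB1 E).prodMap (mB2 H)) := by
  let fV : (Fin q → ℂ) →ₗ[ℂ] MV E × MU H :=
    (blk γ q (fun j : Fin N => (j:ℕ)) (fun j => E j + 1)).prod
      (blk γ q (fun j : Fin M => N + (j:ℕ)) H)
  let fU : (Fin p → ℂ) →ₗ[ℂ] MU E × MV H :=
    (blk ρ p (fun j : Fin N => (j:ℕ)) E).prod
      (blk ρ p (fun j : Fin M => N + (j:ℕ)) (fun j => H j + 1))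
  have fV1 : ∀ v (j : Fin N) (k : ℕ), k < E j + 1 → zext ((fV v).1 j) k = (-1) ^ k * zext v (off γ j + k) := by
    intro v j k hk; rw [zext_of_lt _ hk]; rfl
  have fV2 : ∀ v (j : Fin M) (k : ℕ), k < H j → zext ((fV v).2 j) k = (-1) ^ k * zext v (off γ (N+j) + k) := by
    intro v j k hk; rw [zext_of_lt _ hk]; rfl
  have fU1 : ∀ v (j : Fin N) (k : ℕ), k < E j → zext ((fU v).1 j) k = (-1) ^ k * zext v (off ρ j + k) := by
    intro v j k hk; rw [zext_of_lt _ hk]; rfl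
  have fU2 : ∀ v (j : Fin M) (k : ℕ), k < H j + 1 → zext ((fU v).2 j) k = (-1) ^ k * zext v (off ρ (N+j) + k) := by
    intro v j k hk; rw [zext_of_lt _ hk]; rfl
  have hle : ∀ (δ : ℕ → ℕ) (b k : ℕ), b < N + M → k < δ b → off δ b + k < off δ (N+M) := by
    intro δ b k hb hk
    have := off_mono δ (show b + 1 ≤ N + M from hb)
    rw [off_succ] at this; omega
  have iV : Function.Injective fV := by
    rw [← LinearMap.ker_eq_bot, LinearMap.ker_eq_bot']
    intro v hv
    ext y
    obtain ⟨b, hb, k, hk, e⟩ := off_exists γ (N+M) y (by omega)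
    have hy : v y = zext v (off γ b + k) := by rw [← e, zext_fin]
    rw [hy]
    by_cases hbN : b < N
    · have h := fV1 v ⟨b, hbN⟩ k (by rw [← hγ1 ⟨b, hbN⟩]; exact hk)
      rw [hv] at h
      simpa using h.symm
    · obtain ⟨c, rfl⟩ := Nat.exists_eq_add_of_le (not_lt.1 hbN)
      have h := fV2 v ⟨c, by omega⟩ k (by rw [← hγ2 ⟨c, by omega⟩]; exact hk)
      rw [hv] at h
      simpa using h.symm
  have iU : Function.Injective fU := by
    rw [← LinearMap.ker_eq_bot, LinearMap.ker_eq_bot']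
    intro v hv
    ext y
    obtain ⟨b, hb, k, hk, e⟩ := off_exists ρ (N+M) y (by omega)
    have hy : v y = zext v (off ρ b + k) := by rw [← e, zext_fin]
    rw [hy]
    by_cases hbN : b < N
    · have h := fU1 v ⟨b, hbN⟩ k (by rw [← hρ1 ⟨b, hbN⟩]; exact hk)
      rw [hv] at h
      simpa using h.symm
    · obtain ⟨c, rfl⟩ := Nat.exists_eq_add_of_le (not_lt.1 hbN)
      have h := fU2 v ⟨c, by omega⟩ k (by rw [← hρ2 ⟨c, by omega⟩]; exact hk)
      rw [hv] at h
      simpa using h.symm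
  have hsum : ∀ δ : ℕ → ℕ, off δ (N + M) = ∑ j : Fin N, δ j + ∑ j : Fin M, δ (N + j) := by
    intro δ
    rw [off, Finset.sum_range_add, Fin.sum_univ_eq_sum_range (fun j => δ j),
      Fin.sum_univ_eq_sum_range (fun j => δ (N + j))]
  have dV : Module.finrank ℂ (Fin q → ℂ) = Module.finrank ℂ (MV E × MU H) := by
    rw [Module.finrank_prod, finrank_MV, finrank_MU H, Module.finrank_fin_fun, hq, hsum, Finset.sum_congr rfl fun j _ => hγ1 j, Finset.sum_congr rfl fun j _ => hγ2 j]
  have dU : Module.finrank ℂ (Fin p → ℂ) = Module.finrank ℂ (MU E × MV H) := by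
    rw [Module.finrank_prod, finrank_MU E, finrank_MV H, Module.finrank_fin_fun, hp, hsum, Finset.sum_congr rfl fun j _ => hρ1 j, Finset.sum_congr rfl fun j _ => hρ2 j]
  have hcV : ∀ v, LinearEquiv.ofInjectiveOfFinrankEq fV iV dV v = fV v := fun v =>
    LinearMap.congr_fun (LinearEquiv.coe_ofInjectiveOfFinrankEq fV iV dV) v
  have hcU : ∀ v, LinearEquiv.ofInjectiveOfFinrankEq fU iU dU v = fU v := fun v =>
    LinearMap.congr_fun (LinearEquiv.coe_ofInjectiveOfFinrankEq fU iU dU) v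
  refine ⟨LinearEquiv.ofInjectiveOfFinrankEq fV iV dV,
    LinearEquiv.ofInjectiveOfFinrankEq fU iU dU, fun v => ?_, fun v => ?_⟩
  · rw [hcV, hcU, Matrix.mulVecLin_apply]
    have key : ∀ b i, b < N + M → i < ρ b → zext (dsum (N + M) ρ γ (fun _ i j => if i = j then (1:ℂ) else 0) p q *ᵥ v)
        (off ρ b + i) = if i < γ b then zext v (off γ b + i) else 0 := by
      intro b i hb hi
      have hlt : off ρ b + i < p := by rw [hp]; exact hle ρ b i hb hi
      rw [zext_of_lt _ hlt, dsum_mulVec (N+M) ρ γ _ p q hq v b i hb hi _ rfl]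
      simp
    refine Prod.ext ?_ ?_
    · ext j k
      change (-1) ^ (k:ℕ) * zext _ (off ρ j + k) = zext ((fV v).1 j) k
      rw [key j k (by omega) (by rw [hρ1]; exact k.2), if_pos (by rw [hγ1]; omega),
        fV1 v j k (by omega)]
    · ext j k
      change (-1) ^ (k:ℕ) * zext _ (off ρ (N + j) + k) = zext ((fV v).2 j) k
      rw [key (N + j) k (by omega) (by rw [hρ2]; exact k.2), hγ2]
      split_ifs with hk
      · rw [fV2 v j k hk]
      · rw [zext_of_ge _ (by omega), mul_zero]
  · rw [hcV, hcU, Matrix.mulVecLin_apply]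
    have key : ∀ b i, b < N + M → i < ρ b → zext (dsum (N + M) ρ γ (fun b i j => if b < N then (if j = i+1 then (1:ℂ) else 0)
       else (if i = j+1 then 1 else 0)) p q *ᵥ v)
        (off ρ b + i) = if b < N then (if i + 1 < γ b then zext v (off γ b + (i+1)) else 0)
          else if i = 0 then 0 else if i - 1 < γ b then zext v (off γ b + (i - 1)) else 0 := by
      intro b i hb hi
      have hlt : off ρ b + i < p := by rw [hp]; exact hle ρ b i hb hi
      rw [zext_of_lt _ hlt, dsum_mulVec (N+M) ρ γ _ p q hq v b i hb hi _ rfl]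
      by_cases hbN : b < N
      · simp [hbN]
      · rw [if_neg hbN]
        simp only [hbN, if_false]
        cases i with
        | zero => simp
        | succ i => simp
    refine Prod.ext ?_ ?_
    · ext j k
      change (-1) ^ (k:ℕ) * zext _ (off ρ j + k) = - zext ((fV v).1 j) (k+1)
      rw [key j k (by omega) (by rw [hρ1]; exact k.2), if_pos j.2, if_pos (by rw [hγ1]; omega),
        fV1 v j (k+1) (by omega)]
      ring
    · ext j k
      change (-1) ^ (k:ℕ) * zext _ (off ρ (N + j) + k) =
        if (k:ℕ) = 0 then 0 else - zext ((fV v).2 j) (k-1)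
      rw [key (N + j) k (by omega) (by rw [hρ2]; exact k.2), hγ2, if_neg (by omega)]
      split_ifs with hk hk'
      · simp
      · rw [fV2 v j _ hk']
        obtain ⟨k', hk''⟩ := Nat.exists_eq_succ_of_ne_zero hk
        rw [hk'']
        simp only [Nat.succ_eq_add_one, Nat.add_sub_cancel]
        ring
      · omega
end kd

/-- the balanced partition -/
def bal (N a : ℕ) (j : Fin N) : ℕ := if (j:ℕ) < a % N then a / N + 1 else a / N

theorem sum_bal (N a : ℕ) (hN : 0 < N) : ∑ j, bal N a j = a := by
  have h : ∀ j : Fin N, bal N a j = (if (j:ℕ) < a % N then 1 else 0) + a / N := by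
    intro j; unfold bal; split_ifs <;> omega
  simp only [h, Finset.sum_add_distrib]
  rw [Fin.sum_univ_eq_sum_range (fun j => if j < a % N then 1 else 0) N]
  have : ∑ j ∈ range N, (if j < a % N then 1 else 0) = a % N := by
    rw [← Finset.sum_filter]
    have : (range N).filter (fun j => j < a % N) = range (a % N) := by
      ext j; have := Nat.mod_lt a hN; simp; omega
    rw [this]; simp
  rw [this]
  simp
  have := Nat.mod_add_div a N
  linarith

theorem kiso_Ga (m n d r a : ℕ) (hd : 1 ≤ d) (hr : r < m) (hr' : r < n) (ha : a ≤ r * d) :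
    KIso (Ga m n d r a).1.mulVecLin (Ga m n d r a).2.mulVecLin
      ((mA1 (fun j => bal (n-r) a j + d - 1)).prodMap (mA2 (bal (m-r) (r*d-a))))
      ((mB1 (fun j => bal (n-r) a j + d - 1)).prodMap (mB2 (bal (m-r) (r*d-a)))) := by
  unfold Ga genPencil
  dsimp only
  have hN : 0 < n - r := by omega
  have hM : 0 < m - r := by omega
  have s1 := sum_bal (n-r) a hN
  have s2 := sum_bal (m-r) (r*d-a) hM
  have hs := Nat.mod_lt a hN
  have ht := Nat.mod_lt (r*d-a) hM
  have e0 : a % (n-r) + (n-r - a % (n-r)) = n - r := by omega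
  have e1 : a % (n-r) + (n-r - a % (n-r)) + (r*d-a) % (m-r) + (m-r - (r*d-a) % (m-r)) =
    (n-r) + (m-r) := by omega
  have hρ1 : ∀ j : Fin (n-r), secSize (a % (n-r)) (n-r - a % (n-r)) ((r*d - a) % (m-r)) (a/(n-r) + d) (a/(n-r) + d - 1) ((r*d - a)/(m-r) + 1 + 1) ((r*d - a)/(m-r) + 1) j = bal (n-r) a j + d - 1 := by
    intro j
    unfold secSize bal
    rw [e0]
    have := j.2
    generalize a / (n-r) = α
    generalize (r*d-a) / (m-r) = β
    split_ifs <;> omega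
  have hγ1 : ∀ j : Fin (n-r), secSize (a % (n-r)) (n-r - a % (n-r)) ((r*d - a) % (m-r)) (a/(n-r) + d + 1) (a/(n-r) + d - 1 + 1) ((r*d - a)/(m-r) + 1) ((r*d - a)/(m-r)) j = bal (n-r) a j + d - 1 + 1 := by
    intro j
    unfold secSize bal
    rw [e0]
    have := j.2
    generalize a / (n-r) = α
    generalize (r*d-a) / (m-r) = β
    split_ifs <;> omega
  have hρ2 : ∀ j : Fin (m-r), secSize (a % (n-r)) (n-r - a % (n-r)) ((r*d - a) % (m-r)) (a/(n-r) + d) (a/(n-r) + d - 1) ((r*d - a)/(m-r) + 1 + 1) ((r*d - a)/(m-r) + 1) (n - r + j) = bal (m-r) (r*d-a) j + 1 := by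
    intro j
    unfold secSize bal
    rw [e0]
    have := j.2
    generalize a / (n-r) = α
    generalize (r*d-a) / (m-r) = β
    split_ifs <;> omega
  have hγ2 : ∀ j : Fin (m-r), secSize (a % (n-r)) (n-r - a % (n-r)) ((r*d - a) % (m-r)) (a/(n-r) + d + 1) (a/(n-r) + d - 1 + 1) ((r*d - a)/(m-r) + 1) ((r*d - a)/(m-r)) (n - r + j) = bal (m-r) (r*d-a) j := by
    intro j
    unfold secSize bal
    rw [e0]
    have := j.2
    generalize a / (n-r) = α
    generalize (r*d-a) / (m-r) = β
    split_ifs <;> omega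
  have hsum : ∀ δ : ℕ → ℕ, off δ (n - r + (m - r)) = ∑ j : Fin (n-r), δ j + ∑ j : Fin (m-r), δ (n - r + j) := by
    intro δ
    rw [off, Finset.sum_range_add, Fin.sum_univ_eq_sum_range (fun j => δ j),
      Fin.sum_univ_eq_sum_range (fun j => δ (n-r + j))]
  obtain ⟨d, rfl⟩ : ∃ d', d = d' + 1 := ⟨d - 1, by omega⟩
  obtain ⟨N, rfl⟩ : ∃ N, n = N + r := ⟨n - r, by omega⟩
  obtain ⟨M, rfl⟩ : ∃ M, m = M + r := ⟨m - r, by omega⟩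
  rw [e1, e0]
  have e4 : ∀ j, bal (N + r - r) a j + (d+1) - 1 = bal (N + r - r) a j + d := fun j => by omega
  refine kiso_dsum _ _ _ _ hρ1 hγ1 hρ2 hγ2 _ _ ?_ ?_
  · rw [hsum, Finset.sum_congr rfl fun j _ => hρ1 j, Finset.sum_congr rfl fun j _ => hρ2 j]
    simp only [e4]
    rw [Finset.sum_add_distrib, Finset.sum_add_distrib, s1, s2]
    simp only [Nat.add_sub_cancel, sum_const, card_univ, Fintype.card_fin, smul_eq_mul, mul_one]
    have : a + d * N + (r * (d+1) - a) = d * N + r * (d+1) := by omega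
    have h3 : (M + r) + (N + r) * d = (d * N + r * (d+1)) + M := by ring
    have h4 : N * d = d * N := by ring
    omega
  · rw [hsum, Finset.sum_congr rfl fun j _ => hγ1 j, Finset.sum_congr rfl fun j _ => hγ2 j]
    simp only [e4]
    rw [Finset.sum_add_distrib, Finset.sum_add_distrib, s1, s2]
    simp only [Nat.add_sub_cancel, sum_const, card_univ, Fintype.card_fin, smul_eq_mul, mul_one]
    have h3 : (N + r) * (d+1) = (N * d + r * (d+1)) + N := by ring
    omega


/-! ### Nice companion form -/
section nice
variable {X Y : Type} [Fintype X] [Fintype Y]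

/-- the `λ`-part of a reindexed companion form -/
noncomputable def nA (δ : ℕ) (P : ℕ → Y → X → ℂ) :
    (X → Fin (δ+1) → ℂ) →ₗ[ℂ] (Y → ℂ) × (X → Fin δ → ℂ) where
  toFun w := (fun h => ∑ x, P (δ+1) h x * zext (w x) δ, fun x l => zext (w x) l)
  map_add' u v := by
    refine Prod.ext ?_ ?_
    · ext h; simp [mul_add, Finset.sum_add_distrib]
    · ext x l; simp
  map_smul' c v := by
    refine Prod.ext ?_ ?_
    · ext h; simp [Finset.mul_sum]; congr 1; ext x; ring
    · ext x l; simp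

/-- the constant part of a reindexed companion form -/
noncomputable def nB (δ : ℕ) (P : ℕ → Y → X → ℂ) :
    (X → Fin (δ+1) → ℂ) →ₗ[ℂ] (Y → ℂ) × (X → Fin δ → ℂ) where
  toFun w := (fun h => ∑ x, ∑ k ∈ range (δ+1), P k h x * zext (w x) k,
    fun x l => - zext (w x) (l+1))
  map_add' u v := by
    refine Prod.ext ?_ ?_
    · ext h; simp [mul_add, Finset.sum_add_distrib]
    · ext x l; simp; ring
  map_smul' c v := by
    refine Prod.ext ?_ ?_
    · ext h; simp [Finset.mul_sum]; congr 1; ext x; congr 1; ext k; ring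
    · ext x l; simp

theorem kiso_comp (m n δ : ℕ) (eX : X ≃ Fin n) (eY : Y ≃ Fin m) (P : ℕ → Y → X → ℂ)
    (Q : Pol (δ+1) m n) (hQ : ∀ k i j, Q k i j = P k (eY.symm i) (eX.symm j)) :
    KIso (comp m n (δ+1) Q).1.mulVecLin (comp m n (δ+1) Q).2.mulVecLin (nA δ P) (nB δ P) := by
  have cX : Fintype.card X = n := by rw [Fintype.card_congr eX]; simp
  have cY : Fintype.card Y = m := by rw [Fintype.card_congr eY]; simp
  have hlt : ∀ (l D : ℕ) (x : X), l < D → l * n + (eX x : ℕ) < n * D := by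
    intro l D x hl
    have h1 := (eX x).2
    have h2 : n * (l + 1) ≤ n * D := Nat.mul_le_mul_left _ hl
    nlinarith
  have huniq : ∀ (l l' : ℕ) (x x' : X), l * n + (eX x : ℕ) = l' * n + (eX x' : ℕ) →
      l = l' ∧ x = x' := by
    intro l l' x x' h
    have h1 := (eX x).2
    have h2 := (eX x').2
    have hl : l = l' := by
      rcases lt_trichotomy l l' with h3 | h3 | h3
      · have : (l+1) * n ≤ l' * n := Nat.mul_le_mul_right _ h3
        rw [add_mul] at this; omega
      · exact h3
      · have : (l'+1) * n ≤ l * n := Nat.mul_le_mul_right _ h3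
        rw [add_mul] at this; omega
    subst hl
    exact ⟨rfl, eX.injective (Fin.ext (by omega))⟩
  let fσ : X × Fin (δ+1) → Fin (n * (δ+1)) := fun c =>
    ⟨(δ - c.2) * n + eX c.1, hlt _ _ _ (by omega)⟩
  have hσ : Function.Bijective fσ := by
    rw [Fintype.bijective_iff_injective_and_card]
    refine ⟨?_, by simp [cX]⟩
    rintro ⟨x, l⟩ ⟨x', l'⟩ h
    obtain ⟨h1, h2⟩ := huniq _ _ _ _ (Fin.ext_iff.1 h)
    dsimp only at h1 h2
    refine Prod.ext h2 (Fin.ext ?_)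
    dsimp only
    omega
  let σ := Equiv.ofBijective fσ hσ
  let fτ : Y ⊕ X × Fin δ → Fin (m + n * (δ+1-1)) := Sum.elim
    (fun h => ⟨eY h, by have := (eY h).2; omega⟩)
    (fun c => ⟨m + ((δ - 1 - c.2) * n + eX c.1), by
      have := hlt (δ - 1 - c.2) δ c.1 (by omega)
      simp only [Nat.add_sub_cancel]; omega⟩)
  have hτ : Function.Bijective fτ := by
    rw [Fintype.bijective_iff_injective_and_card]
    refine ⟨?_, by simp [cX, cY]⟩
    rintro (h | ⟨x, l⟩) (h' | ⟨x', l'⟩) e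
    · have := Fin.ext_iff.1 e
      simp only [fτ, Sum.elim_inl] at this
      exact congrArg _ (eY.injective (Fin.ext this))
    · have := Fin.ext_iff.1 e
      simp [fτ] at this
      have := (eY h).2
      omega
    · have := Fin.ext_iff.1 e
      simp [fτ] at this
      have := (eY h').2
      omega
    · have := Fin.ext_iff.1 e
      simp only [fτ, Sum.elim_inr, add_right_inj] at this
      obtain ⟨h1, h2⟩ := huniq _ _ _ _ this
      congr 1
      refine Prod.ext h2 (Fin.ext ?_)
      dsimp only
      omega
  let τ := Equiv.ofBijective fτ hτ
  let eV : (Fin (n * (δ+1)) → ℂ) ≃ₗ[ℂ] (X → Fin (δ+1) → ℂ) :=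
    (LinearEquiv.funCongrLeft ℂ ℂ σ).trans (LinearEquiv.curry ℂ ℂ X (Fin (δ+1)))
  let eU : (Fin (m + n * (δ+1-1)) → ℂ) ≃ₗ[ℂ] (Y → ℂ) × (X → Fin δ → ℂ) :=
    { toFun := fun z => (fun h => z (τ (Sum.inl h)), fun x l => z (τ (Sum.inr (x, l))))
      map_add' := fun _ _ => rfl
      map_smul' := fun _ _ => rfl
      invFun := fun p i => Sum.elim p.1 (fun c => p.2 c.1 c.2) (τ.symm i)
      left_inv := by
        intro z
        ext i
        obtain ⟨y, rfl⟩ := τ.surjective i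
        dsimp only
        rw [Equiv.symm_apply_apply]
        rcases y with h | ⟨x, l⟩ <;> rfl
      right_inv := by
        intro p
        refine Prod.ext ?_ ?_
        · ext h; simp
        · ext x l; simp }
  have heV : ∀ v x l, eV v x l = v (σ (x, l)) := fun v x l => rfl
  have hmv : ∀ (A : Matrix (Fin (m + n * (δ+1-1))) (Fin (n * (δ+1))) ℂ) v i,
      (A *ᵥ v) i = ∑ x, ∑ l, A i (σ (x, l)) * eV v x l := by
    intro A v i
    rw [Matrix.mulVec, dotProduct, ← σ.sum_comp, Fintype.sum_prod_type]
    rfl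
  have t1 : ∀ h, ((τ (Sum.inl h) : Fin _) : ℕ) = eY h := fun h => rfl
  have t2 : ∀ x l, ((τ (Sum.inr (x, l)) : Fin _) : ℕ) = m + ((δ - 1 - l) * n + eX x) := fun _ _ => rfl
  have s1 : ∀ x l, ((σ (x, l) : Fin _) : ℕ) = (δ - l) * n + eX x := fun _ _ => rfl
  have hn : ∀ x : X, 0 < n := fun x => lt_of_le_of_lt (Nat.zero_le _) (eX x).2
  have hdiv : ∀ (l : ℕ) (x : X), (l * n + (eX x : ℕ)) / n = l := by
    intro l x
    rw [mul_comm, Nat.mul_add_div (hn x), Nat.div_eq_of_lt (eX x).2, add_zero]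
  have hmod : ∀ (l : ℕ) (x : X), (l * n + (eX x : ℕ)) % n = eX x := by
    intro l x
    rw [mul_comm, Nat.mul_add_mod, Nat.mod_eq_of_lt (eX x).2]
  refine ⟨eV, eU, fun v => Prod.ext ?_ ?_, fun v => Prod.ext ?_ ?_⟩
  · ext h
    change (_ *ᵥ v) (τ (Sum.inl h)) = ∑ x, P (δ+1) h x * zext (eV v x) δ
    rw [hmv]
    refine Finset.sum_congr rfl fun x _ => ?_
    have h0 := (eY h).2
    rw [Fintype.sum_eq_single (Fin.last δ)]
    · rw [zext_of_lt _ (Nat.lt_succ_self δ)]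
      congr 1
      simp only [comp, compA, t1, s1]
      rw [dif_pos h0, dif_pos (by simp)]
      rw [hQ]
      congr 1
      · simp
      · simp
    · intro l hl
      simp only [comp, compA, t1, s1]
      rw [dif_pos h0, dif_neg, zero_mul]
      have : (l:ℕ) ≠ δ := fun h => hl (Fin.ext h)
      have : 1 * n ≤ (δ - l) * n := Nat.mul_le_mul_right _ (by omega)
      omega
  · ext x l
    change (_ *ᵥ v) (τ (Sum.inr (x, l))) = zext (eV v x) l
    rw [hmv, Fintype.sum_eq_single x, Fintype.sum_eq_single (l.castSucc)]
    · rw [zext_of_lt _ (by omega)]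
      simp only [comp, compA, t2, s1]
      rw [dif_neg (by omega), if_pos, one_mul]
      · rfl
      · obtain ⟨q, hq⟩ : ∃ q, δ - l = q + 1 := ⟨δ - l - 1, by omega⟩
        have : δ - 1 - l = q := by omega
        simp only [Fin.val_castSucc]
        rw [hq, this, add_mul]
        omega
    · intro l' hl'
      simp only [comp, compA, t2, s1]
      rw [dif_neg (by omega), if_neg, zero_mul]
      rintro ⟨h1, h2⟩
      have h3 : (δ - 1 - (l:ℕ) + 1) * n + eX x = (δ - (l':ℕ)) * n + eX x := by
        rw [add_mul]; omega
      obtain ⟨h4, -⟩ := huniq _ _ _ _ h3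
      apply hl'; ext; simp; omega
    · intro x' hx'
      refine Finset.sum_eq_zero fun l' _ => ?_
      simp only [comp, compA, t2, s1]
      rw [dif_neg (by omega), if_neg, zero_mul]
      rintro ⟨h1, h2⟩
      have h3 : (δ - 1 - (l:ℕ) + 1) * n + eX x = (δ - (l':ℕ)) * n + eX x' := by
        rw [add_mul]; omega
      obtain ⟨-, h4⟩ := huniq _ _ _ _ h3
      exact hx' h4.symm
  · ext h
    change (_ *ᵥ v) (τ (Sum.inl h)) = ∑ x, ∑ k ∈ range (δ+1), P k h x * zext (eV v x) k
    rw [hmv]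
    refine Finset.sum_congr rfl fun x _ => ?_
    have h0 := (eY h).2
    rw [← Fin.sum_univ_eq_sum_range (fun k => P k h x * zext (eV v x) k)]
    refine Finset.sum_congr rfl fun l _ => ?_
    rw [zext_fin]
    congr 1
    simp only [comp, compB, t1, s1]
    rw [dif_pos h0, dif_pos (hn x), hQ]
    simp only [hdiv, hmod]
    congr 1
    · omega
    · simp
    · simp
  · ext x l
    change (_ *ᵥ v) (τ (Sum.inr (x, l))) = - zext (eV v x) (l+1)
    rw [hmv, Fintype.sum_eq_single x, Fintype.sum_eq_single (l.succ)]
    · rw [zext_of_lt _ (by omega)]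
      simp only [comp, compB, t2, s1]
      rw [dif_neg (by omega), if_pos, neg_one_mul]
      · rfl
      · have : δ - 1 - (l:ℕ) = δ - (l+1) := by omega
        simp only [Fin.val_succ]
        rw [this]
        omega
    · intro l' hl'
      simp only [comp, compB, t2, s1]
      rw [dif_neg (by omega), if_neg, zero_mul]
      intro h1
      have h3 : (δ - 1 - (l:ℕ)) * n + eX x = (δ - (l':ℕ)) * n + eX x := by
        omega
      obtain ⟨h4, -⟩ := huniq _ _ _ _ h3
      apply hl'; ext; simp; omega
    · intro x' hx'
      refine Finset.sum_eq_zero fun l' _ => ?_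
      simp only [comp, compB, t2, s1]
      rw [dif_neg (by omega), if_neg, zero_mul]
      intro h1
      have h3 : (δ - 1 - (l:ℕ)) * n + eX x = (δ - (l':ℕ)) * n + eX x' := by
        omega
      obtain ⟨-, h4⟩ := huniq _ _ _ _ h3
      exact hx' h4.symm
end nice


/-! ### The explicit polynomial -/
structure Dat where
  N : ℕ
  r : ℕ
  M : ℕ
  δ : ℕ
  e : ℕ → ℕ
  η : ℕ → ℕ
  hsum : off e (N+1) + off η M = r * (δ+1)

namespace Dat
variable (Δ : Dat)

abbrev X := Fin Δ.N ⊕ Fin (Δ.r+1)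
abbrev Y := Fin Δ.M ⊕ Fin Δ.r
abbrev FF := Δ.X → ℕ → ℂ

def b : ℕ := off Δ.η Δ.M
def c (j : ℕ) : ℕ := off Δ.e j
def o (j : ℕ) : ℕ := off Δ.η j
def g (i : ℕ) : ℕ := i * (Δ.δ+1) - Δ.b
def D (i : ℕ) : ℕ := Δ.g (i+1) - Δ.g i
def f (i : ℕ) : ℕ := Δ.δ + 1 - Δ.D i
def J (i : ℕ) : ℕ := Nat.findGreatest (fun j => Δ.c j ≤ Δ.g i) Δ.N

theorem c_zero : Δ.c 0 = 0 := by simp [c, off]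
theorem c_succ (j : ℕ) : Δ.c (j+1) = Δ.c j + Δ.e j := off_succ _ _
theorem c_mono {i j : ℕ} (h : i ≤ j) : Δ.c i ≤ Δ.c j := off_mono _ h
theorem o_zero : Δ.o 0 = 0 := by simp [o, off]
theorem o_succ (j : ℕ) : Δ.o (j+1) = Δ.o j + Δ.η j := off_succ _ _
theorem o_mono {i j : ℕ} (h : i ≤ j) : Δ.o i ≤ Δ.o j := off_mono _ h
theorem o_le {j : ℕ} (h : j ≤ Δ.M) : Δ.o j ≤ Δ.b := off_mono _ h
theorem cb : Δ.c (Δ.N+1) + Δ.b = Δ.r * (Δ.δ+1) := Δ.hsum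

theorem g_zero : Δ.g 0 = 0 := by simp [g]
theorem g_r : Δ.g Δ.r = Δ.c (Δ.N+1) := by have := Δ.cb; unfold g; omega
theorem g_le (i : ℕ) : Δ.g i ≤ Δ.g (i+1) := by unfold g; rw [add_mul]; omega
theorem g_le' (i : ℕ) : Δ.g (i+1) ≤ Δ.g i + (Δ.δ+1) := by unfold g; rw [add_mul]; omega
theorem g_mono {i j : ℕ} (h : i ≤ j) : Δ.g i ≤ Δ.g j := by
  induction h with
  | refl => exact le_rfl
  | step _ ih => exact ih.trans (Δ.g_le _)
theorem D_le (i : ℕ) : Δ.D i ≤ Δ.δ+1 := by have := Δ.g_le' i; unfold D; omega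
theorem gD (i : ℕ) : Δ.g i + Δ.D i = Δ.g (i+1) := by have := Δ.g_le i; unfold D; omega
theorem fD (i : ℕ) : Δ.f i + Δ.D i = Δ.δ+1 := by have := Δ.D_le i; unfold f; omega

theorem f_eq (i : ℕ) : Δ.f i = min (Δ.δ+1) (Δ.b - i * (Δ.δ+1)) := by
  unfold f D g; rw [add_mul]; omega

theorem lt_r {i : ℕ} (h : i * (Δ.δ+1) < Δ.b) : i < Δ.r := by
  have := Δ.cb
  exact lt_of_mul_lt_mul_right (lt_of_lt_of_le h (by omega)) (Nat.zero_le (Δ.δ+1))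

theorem J_le (i : ℕ) : Δ.J i ≤ Δ.N := Nat.findGreatest_le _
theorem c_J (i : ℕ) : Δ.c (Δ.J i) ≤ Δ.g i :=
  Nat.findGreatest_spec (P := fun j => Δ.c j ≤ Δ.g i) (m := 0) (Nat.zero_le _) (by simp [c_zero])
theorem J_iff (i j : ℕ) (hj : j ≤ Δ.N) : Δ.c j ≤ Δ.g i ↔ j ≤ Δ.J i := by
  constructor
  · intro h; exact Nat.le_findGreatest hj h
  · intro h; exact (Δ.c_mono h).trans (Δ.c_J i)
theorem J_mono {i j : ℕ} (h : i ≤ j) : Δ.J i ≤ Δ.J j :=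
  (Δ.J_iff _ _ (Δ.J_le i)).1 ((Δ.c_J i).trans (Δ.g_mono h))
theorem J_r : Δ.J Δ.r = Δ.N := by
  apply le_antisymm (Δ.J_le _)
  rw [← J_iff _ _ _ le_rfl, g_r]; exact Δ.c_mono (by omega)
theorem g_le_c (i : ℕ) (hi : i ≤ Δ.r) : Δ.g i ≤ Δ.c (Δ.J i + 1) := by
  by_cases h : Δ.J i + 1 ≤ Δ.N
  · have := (Δ.J_iff i _ h).not.2 (by omega)
    omega
  · have : Δ.J i = Δ.N := by have := Δ.J_le i; omega
    rw [this, ← g_r]; exact Δ.g_mono hi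

noncomputable def vx (F : Δ.FF) (i l : ℕ) : ℂ :=
  if h : i < Δ.r + 1 then F (Sum.inr ⟨i, h⟩) l else 0

noncomputable def RR (i l : ℕ) : Δ.FF →ₗ[ℂ] ℂ where
  toFun F := Δ.vx F (i+1) l - Δ.vx F i (l + Δ.D i) - ∑ j : Fin Δ.N,
    if Δ.J i < j + 1 ∧ j + 1 ≤ Δ.J (i+1) then F (Sum.inl j) (l + (Δ.g (i+1) - Δ.c (j+1))) else 0
  map_add' F G := by
    have : ∀ i l, Δ.vx (F + G) i l = Δ.vx F i l + Δ.vx G i l := by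
      intro i l; unfold vx; split_ifs <;> simp
    rw [this, this]
    have h : ∀ j : Fin Δ.N, (if Δ.J i < j + 1 ∧ j + 1 ≤ Δ.J (i+1) then (F + G) (Sum.inl j) (l + (Δ.g (i+1) - Δ.c (j+1))) else 0)
      = (if Δ.J i < j + 1 ∧ j + 1 ≤ Δ.J (i+1) then F (Sum.inl j) (l + (Δ.g (i+1) - Δ.c (j+1))) else 0) + (if Δ.J i < j + 1 ∧ j + 1 ≤ Δ.J (i+1) then G (Sum.inl j) (l + (Δ.g (i+1) - Δ.c (j+1))) else 0) := by
      intro j; split_ifs <;> simp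
    rw [Finset.sum_congr rfl fun j _ => h j, Finset.sum_add_distrib]
    ring
  map_smul' a F := by
    have : ∀ i l, Δ.vx (a • F) i l = a * Δ.vx F i l := by
      intro i l; unfold vx; split_ifs <;> simp
    rw [this, this]
    simp only [RingHom.id_apply, smul_eq_mul, mul_sub, Finset.mul_sum]
    congr 1
    refine Finset.sum_congr rfl fun j _ => ?_
    split_ifs <;> simp

theorem RR_apply (i l : ℕ) (F : Δ.FF) : Δ.RR i l F =
    Δ.vx F (i+1) l - Δ.vx F i (l + Δ.D i) - ∑ j : Fin Δ.N,
    if Δ.J i < j + 1 ∧ j + 1 ≤ Δ.J (i+1) then F (Sum.inl j) (l + (Δ.g (i+1) - Δ.c (j+1))) else 0 := rfl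

theorem c_gt (i : ℕ) (j : Fin Δ.N) (h : Δ.J i < j + 1) : Δ.g i < Δ.c (j+1) := by
  have := (Δ.J_iff i (j+1) j.2).not.2 (by omega)
  omega

theorem RR_congr (i l : ℕ) (F G : Δ.FF) (h : ∀ x k, l ≤ k → k ≤ l + Δ.D i → F x k = G x k) :
    Δ.RR i l F = Δ.RR i l G := by
  rw [RR_apply, RR_apply]
  have h1 : ∀ i k, l ≤ k → k ≤ l + Δ.D i → True := fun _ _ _ _ => trivial
  congr 1
  · congr 1
    · unfold vx; split_ifs
      · exact h _ _ le_rfl (by omega)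
      · rfl
    · unfold vx; split_ifs
      · exact h _ _ (by omega) (by omega)
      · rfl
  · refine Finset.sum_congr rfl fun j _ => ?_
    split_ifs with hj
    · have := Δ.c_gt i j hj.1
      have := Δ.gD i
      exact h _ _ (by omega) (by omega)
    · rfl

theorem RR_zero (i l : ℕ) (F : Δ.FF) (h : ∀ x k, l ≤ k → k ≤ l + Δ.D i → F x k = 0) :
    Δ.RR i l F = 0 := by
  rw [Δ.RR_congr i l F 0 h, map_zero]

theorem RR_shift (i l : ℕ) (F : Δ.FF) : Δ.RR i l (fun x k => F x (k+1)) = Δ.RR i (l+1) F := by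
  rw [RR_apply, RR_apply]
  congr 1
  · have : l + Δ.D i + 1 = l + 1 + Δ.D i := by omega
    simp only [vx, this]
  · refine Finset.sum_congr rfl fun j _ => ?_
    split_ifs with hj
    · congr 1; omega
    · rfl

noncomputable def yp (s : ℕ) : Δ.FF →ₗ[ℂ] ℂ :=
  if 0 < s then Δ.RR ((Δ.b - s) / (Δ.δ+1)) ((Δ.b - s) % (Δ.δ+1)) else 0

noncomputable def top : Δ.Y → Δ.FF →ₗ[ℂ] ℂ
  | Sum.inl j => Δ.yp (Δ.o (j+1))
  | Sum.inr i => Δ.RR i (Δ.f i) - if ((i:ℕ)+1) * (Δ.δ+1) < Δ.b then Δ.RR (i+1) 0 else 0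

/-- division data -/
theorem div_data (s : ℕ) (hs : 0 < s) (hb : s ≤ Δ.b) : ∃ i l, (Δ.b - s) / (Δ.δ+1) = i ∧
    (Δ.b - s) % (Δ.δ+1) = l ∧ i * (Δ.δ+1) + l + s = Δ.b ∧ l < Δ.δ+1 ∧ i < Δ.r ∧ l < Δ.f i ∧
      l + Δ.D i < Δ.δ + 1 := by
  have h1 := Nat.div_add_mod' (Δ.b - s) (Δ.δ+1)
  have h2 : (Δ.b - s) % (Δ.δ+1) < Δ.δ + 1 := Nat.mod_lt (Δ.b - s) (Nat.succ_pos Δ.δ)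
  refine ⟨_, _, rfl, rfl, by omega, h2, Δ.lt_r (by omega), ?_⟩
  have h3 : (Δ.b - s) % (Δ.δ+1) < Δ.f ((Δ.b - s) / (Δ.δ+1)) := by rw [f_eq]; omega
  have := Δ.fD ((Δ.b - s) / (Δ.δ+1))
  exact ⟨h3, by omega⟩

theorem yp_congr (s : ℕ) (hb : s ≤ Δ.b) (F G : Δ.FF) (h : ∀ x k, k ≤ Δ.δ → F x k = G x k) :
    Δ.yp s F = Δ.yp s G := by
  unfold yp
  split_ifs with hs
  · obtain ⟨i, l, e1, e2, -, -, -, -, h3⟩ := Δ.div_data s hs hb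
    rw [e1, e2]
    exact Δ.RR_congr _ _ _ _ fun x k _ hk => h x k (by omega)
  · rfl

theorem f_next (i : ℕ) (h : (i+1) * (Δ.δ+1) < Δ.b) : Δ.D (i+1) ≤ Δ.δ := by
  have h1 := Δ.f_eq (i+1)
  have h2 := Δ.fD (i+1)
  omega

theorem top_congr (h : Δ.Y) (F G : Δ.FF) (hFG : ∀ x k, k ≤ Δ.δ+1 → F x k = G x k) :
    Δ.top h F = Δ.top h G := by
  rcases h with j | i
  · exact Δ.yp_congr _ (Δ.o_le j.2) _ _ fun x k hk => hFG x k (by omega)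
  · simp only [top, LinearMap.sub_apply]
    have := Δ.fD i
    congr 1
    · exact Δ.RR_congr _ _ _ _ fun x k _ hk => hFG x k (by omega)
    · split_ifs with hi
      · have := Δ.D_le (i+1)
        exact Δ.RR_congr _ _ _ _ fun x k _ hk => hFG x k (by omega)
      · rfl

/-- the kernel vectors -/
noncomputable def W (u : ℕ → ℕ → ℂ) : Δ.FF
  | Sum.inl j, l => u (j+1) l - u j (Δ.e j + l)
  | Sum.inr i, l => u (Δ.J i) (Δ.g i + l - Δ.c (Δ.J i))

theorem W_shift (u : ℕ → ℕ → ℂ) (x : Δ.X) (l : ℕ) :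
    Δ.W (fun j k => u j (k+1)) x l = Δ.W u x (l+1) := by
  rcases x with j | i
  · rfl
  · have := Δ.c_J i
    simp only [W]; congr 1; omega

theorem RR_W (i l : ℕ) (hi : i < Δ.r) (u : ℕ → ℕ → ℂ) : Δ.RR i l (Δ.W u) = 0 := by
  rw [RR_apply]
  have h1 : Δ.vx (Δ.W u) (i+1) l = u (Δ.J (i+1)) (Δ.g (i+1) + l - Δ.c (Δ.J (i+1))) := by
    unfold vx; rw [dif_pos (by omega)]; rfl
  have h2 : Δ.vx (Δ.W u) i (l + Δ.D i) = u (Δ.J i) (Δ.g (i+1) + l - Δ.c (Δ.J i)) := by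
    unfold vx; rw [dif_pos (by omega)]
    have := Δ.gD i
    change u _ _ = u _ _
    congr 1; dsimp only; omega
  have h3 : ∑ j : Fin Δ.N, (if Δ.J i < j + 1 ∧ j + 1 ≤ Δ.J (i+1) then
      Δ.W u (Sum.inl j) (l + (Δ.g (i+1) - Δ.c (j+1))) else 0) =
      ∑ j ∈ Ico (Δ.J i) (Δ.J (i+1)), (u (j+1) (Δ.g (i+1) + l - Δ.c (j+1)) -
        u j (Δ.g (i+1) + l - Δ.c j)) := by
    have hW : ∀ j : Fin Δ.N, Δ.W u (Sum.inl j) (l + (Δ.g (i+1) - Δ.c (j+1))) =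
      (u (j+1) (l + (Δ.g (i+1) - Δ.c (j+1))) - u j (Δ.e j + (l + (Δ.g (i+1) - Δ.c (j+1))))) :=
      fun j => rfl
    simp only [hW]
    rw [Fin.sum_univ_eq_sum_range (fun j => if Δ.J i < j + 1 ∧ j + 1 ≤ Δ.J (i+1) then
      (u (j+1) (l + (Δ.g (i+1) - Δ.c (j+1))) - u j (Δ.e j + (l + (Δ.g (i+1) - Δ.c (j+1))))) else 0),
      ← Finset.sum_filter]
    have hJ := Δ.J_le (i+1)
    refine Finset.sum_congr ?_ ?_
    · ext j; simp only [mem_filter, mem_range, mem_Ico]; omega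
    · intro j hj
      rw [mem_Ico] at hj
      have h4 : Δ.c (j+1) ≤ Δ.g (i+1) := (Δ.J_iff _ _ (by omega)).2 (by omega)
      have h5 := Δ.c_succ j
      congr 2 <;> omega
  rw [h1, h2, h3, Finset.sum_Ico_sub (fun j => u j (Δ.g (i+1) + l - Δ.c j)) (Δ.J_mono (by omega))]
  ring

theorem yp_W (s : ℕ) (hb : s ≤ Δ.b) (u : ℕ → ℕ → ℂ) : Δ.yp s (Δ.W u) = 0 := by
  unfold yp
  split_ifs with hs
  · obtain ⟨i, l, e1, e2, -, -, h3, -⟩ := Δ.div_data s hs hb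
    rw [e1, e2]
    exact Δ.RR_W _ _ h3 u
  · rfl

theorem top_W (h : Δ.Y) (u : ℕ → ℕ → ℂ) : Δ.top h (Δ.W u) = 0 := by
  rcases h with j | i
  · exact Δ.yp_W _ (Δ.o_le j.2) u
  · simp only [top, LinearMap.sub_apply]
    rw [Δ.RR_W _ _ i.2]
    split_ifs with hi
    · rw [Δ.RR_W _ _ (Δ.lt_r hi)]; ring
    · simp

/-- the coefficients -/
noncomputable def P (k : ℕ) (h : Δ.Y) (x : Δ.X) : ℂ :=
  Δ.top h (Pi.single x (Pi.single k 1))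

theorem P_sum (K : ℕ → Prop) [DecidablePred K] (s : Finset ℕ) (hs : ∀ k, k ∈ s ↔ K k) (h : Δ.Y) (F : Δ.FF) :
    ∑ x, ∑ k ∈ s, Δ.P k h x * F x k =
      Δ.top h (fun x k => if K k then F x k else 0) := by
  have : (fun x k => if K k then F x k else 0) =
      ∑ x, ∑ k ∈ s, F x k • (Pi.single x (Pi.single k (1:ℂ)) : Δ.FF) := by
    funext x k
    rw [Finset.sum_apply, Finset.sum_apply, Finset.sum_eq_single x]
    · rw [Finset.sum_apply, Finset.sum_apply]
      by_cases hk : K k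
      · rw [if_pos hk, Finset.sum_eq_single k]
        · simp
        · intro k' _ hne
          simp [Pi.single_apply, hne.symm]
        · intro hn; exact absurd ((hs k).2 hk) hn
      · rw [if_neg hk, Finset.sum_eq_zero]
        intro k' hk'
        have : k ≠ k' := fun e => hk ((hs k).1 (e ▸ hk'))
        simp [Pi.single_apply, this]
    · intro x' _ hne
      rw [Finset.sum_apply, Finset.sum_apply]
      refine Finset.sum_eq_zero fun k' _ => ?_
      simp [Pi.single_apply, hne.symm]
    · intro hn; exact absurd (Finset.mem_univ x) hn
  rw [this, map_sum]
  refine Finset.sum_congr rfl fun x _ => ?_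
  rw [map_sum]
  refine Finset.sum_congr rfl fun k _ => ?_
  rw [map_smul, smul_eq_mul, mul_comm]
  rfl

end Dat

namespace Dat
variable (Δ : Dat)

abbrev E : Fin (Δ.N+1) → ℕ := fun j => Δ.e j + Δ.δ
abbrev H : Fin Δ.M → ℕ := fun j => Δ.η j
abbrev VV := Δ.X → Fin (Δ.δ+1) → ℂ
abbrev UU := (Δ.Y → ℂ) × (Δ.X → Fin Δ.δ → ℂ)

noncomputable def zf {n : ℕ} (w : Δ.X → Fin n → ℂ) : Δ.FF := fun x k => zext (w x) k
theorem zf_add {n : ℕ} (w v : Δ.X → Fin n → ℂ) : Δ.zf (w + v) = Δ.zf w + Δ.zf v := by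
  funext x k; simp [zf]
theorem zf_smul {n : ℕ} (a : ℂ) (v : Δ.X → Fin n → ℂ) : Δ.zf (a • v) = a • Δ.zf v := by
  funext x k; simp [zf]

noncomputable abbrev A := nA Δ.δ Δ.P
noncomputable abbrev B := nB Δ.δ Δ.P

theorem A_fst (w : Δ.VV) (h : Δ.Y) :
    (Δ.A w).1 h = Δ.top h (fun x k => if k = Δ.δ+1 then zext (w x) Δ.δ else 0) := by
  rw [← Δ.P_sum (fun k => k = Δ.δ+1) {Δ.δ+1} (by simp) h (fun x k => zext (w x) Δ.δ)]
  simp only [Finset.sum_singleton]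
  rfl

theorem B_fst (w : Δ.VV) (h : Δ.Y) : (Δ.B w).1 h = Δ.top h (Δ.zf w) := by
  have : Δ.zf w = (fun x k => if k < Δ.δ+1 then zext (w x) k else 0) := by
    funext x k
    split_ifs with hk
    · rfl
    · exact zext_of_ge _ (by omega)
  rw [this, ← Δ.P_sum (fun k => k < Δ.δ+1) (range (Δ.δ+1)) (by simp) h (fun x k => zext (w x) k)]
  rfl

theorem A_snd (w : Δ.VV) (x : Δ.X) (k : ℕ) :
    Δ.zf (Δ.A w).2 x k = if k < Δ.δ then zext (w x) k else 0 := by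
  unfold zf
  split_ifs with h
  · rw [zext_of_lt _ h]; rfl
  · exact zext_of_ge _ (by omega)

theorem B_snd (w : Δ.VV) (x : Δ.X) (k : ℕ) : Δ.zf (Δ.B w).2 x k = - Δ.zf w x (k+1) := by
  unfold zf
  by_cases h : k < Δ.δ
  · rw [zext_of_lt _ h]; rfl
  · rw [zext_of_ge _ (by omega), zext_of_ge _ (by omega), neg_zero]

/-! projections -/
noncomputable def tI (z : Δ.Y → ℂ) (s : ℕ) : ℂ :=
  if h : 0 < s ∧ s ≤ Δ.M then z (Sum.inl ⟨s-1, by omega⟩) else 0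
noncomputable def tR (z : Δ.Y → ℂ) (i : ℕ) : ℂ := if h : i < Δ.r then z (Sum.inr ⟨i, h⟩) else 0
theorem tI_add (z z' : Δ.Y → ℂ) (s : ℕ) : Δ.tI (z + z') s = Δ.tI z s + Δ.tI z' s := by
  unfold tI; split_ifs <;> simp
theorem tI_smul (a : ℂ) (z' : Δ.Y → ℂ) (s : ℕ) : Δ.tI (a • z') s = a * Δ.tI z' s := by
  unfold tI; split_ifs <;> simp
theorem tR_add (z z' : Δ.Y → ℂ) (s : ℕ) : Δ.tR (z + z') s = Δ.tR z s + Δ.tR z' s := by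
  unfold tR; split_ifs <;> simp
theorem tR_smul (a : ℂ) (z' : Δ.Y → ℂ) (s : ℕ) : Δ.tR (a • z') s = a * Δ.tR z' s := by
  unfold tR; split_ifs <;> simp

noncomputable def raw0 (i l : ℕ) (z : Δ.UU) : ℂ :=
  (if l + 1 = Δ.f i then Δ.tR z.1 i else 0) + Δ.RR i l (Δ.zf z.2)
noncomputable def raw (s : ℕ) (z : Δ.UU) : ℂ :=
  Δ.raw0 ((Δ.b - s) / (Δ.δ+1)) ((Δ.b - s) % (Δ.δ+1)) z

theorem raw_add (s : ℕ) (z z' : Δ.UU) : Δ.raw s (z + z') = Δ.raw s z + Δ.raw s z' := by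
  unfold raw raw0
  simp only [Prod.fst_add, Prod.snd_add, tR_add, zf_add, map_add]
  split_ifs <;> ring
theorem raw_smul (s : ℕ) (a : ℂ) (z' : Δ.UU) : Δ.raw s (a • z') = a * Δ.raw s z' := by
  unfold raw raw0
  simp only [Prod.smul_fst, Prod.smul_snd, tR_smul, zf_smul, map_smul, smul_eq_mul]
  split_ifs <;> ring

noncomputable def πV : Δ.VV →ₗ[ℂ] MU Δ.H where
  toFun w j k := Δ.yp (Δ.o j + k + 1) (Δ.zf w)
  map_add' u v := by ext j k; simp [zf_add]
  map_smul' a v := by ext j k; simp [zf_smul]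

noncomputable def πU : Δ.UU →ₗ[ℂ] MV Δ.H where
  toFun z j k := (if (k:ℕ) < Δ.η j then Δ.raw (Δ.o j + k + 1) z else 0) +
    (if (k:ℕ) = 0 then Δ.tI z.1 j else 0) - (if (k:ℕ) = Δ.η j then Δ.tI z.1 (j+1) else 0)
  map_add' u v := by
    ext j k
    simp only [raw_add, tI_add, Prod.fst_add, Pi.add_apply]
    split_ifs <;> ring
  map_smul' a v := by
    ext j k
    simp only [raw_smul, tI_smul, Prod.smul_fst, Pi.smul_apply, smul_eq_mul, RingHom.id_apply]
    split_ifs <;> ring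

theorem tI_A (w : Δ.VV) (s : ℕ) : Δ.tI (Δ.A w).1 s = 0 := by
  unfold tI
  split_ifs with h
  · rw [A_fst]
    change Δ.yp _ _ = 0
    rw [Δ.yp_congr _ (Δ.o_le (by dsimp only; omega)) _ 0, map_zero]
    intro x k hk
    rw [if_neg (by omega)]; rfl
  · rfl

theorem tI_B (w : Δ.VV) (s : ℕ) (hs : s ≤ Δ.M) : Δ.tI (Δ.B w).1 s = Δ.yp (Δ.o s) (Δ.zf w) := by
  unfold tI
  split_ifs with h
  · rw [B_fst]
    change Δ.yp (Δ.o (s - 1 + 1)) _ = _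
    rw [show s - 1 + 1 = s by omega]
  · have : s = 0 := by omega
    rw [this, o_zero]; simp [yp]

theorem raw_A (w : Δ.VV) (s : ℕ) (hs : 0 < s) (hb : s ≤ Δ.b) :
    Δ.raw s (Δ.A w) = Δ.yp s (Δ.zf w) := by
  obtain ⟨i, l, e1, e2, h1, h2, h3, h4, h5⟩ := Δ.div_data s hs hb
  unfold raw yp raw0
  rw [if_pos hs, e1, e2]
  have hfD := Δ.fD i
  split_ifs with hl
  · unfold tR
    rw [dif_pos h3, A_fst]
    simp only [top, LinearMap.sub_apply]
    rw [← hl, ← RR_shift]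
    have h0 : (if (i+1) * (Δ.δ+1) < Δ.b then Δ.RR (i+1) 0 else 0)
        (fun x k => if k = Δ.δ+1 then zext (w x) Δ.δ else 0) = 0 := by
      split_ifs with hi
      · have := Δ.f_next i hi
        refine Δ.RR_zero _ _ _ fun x k _ hk => if_neg (by omega)
      · rfl
    rw [h0, sub_zero, ← map_add]
    refine Δ.RR_congr _ _ _ _ fun x k _ hk => ?_
    change (if k + 1 = Δ.δ + 1 then _ else (0:ℂ)) + Δ.zf _ x k = zext (w x) k
    rw [A_snd]
    by_cases hk2 : k = Δ.δ
    · subst hk2; rw [if_pos rfl, if_neg (by omega), add_zero]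
    · rw [if_neg (by omega), if_pos (by omega), zero_add]
  · rw [zero_add]
    refine Δ.RR_congr _ _ _ _ fun x k _ hk => ?_
    rw [A_snd, if_pos (by omega)]
    rfl

theorem raw_B (w : Δ.VV) (s : ℕ) (hs : 0 < s) (hb : s ≤ Δ.b) :
    Δ.raw s (Δ.B w) = - Δ.yp (s-1) (Δ.zf w) := by
  obtain ⟨i, l, e1, e2, h1, h2, h3, h4, h5⟩ := Δ.div_data s hs hb
  unfold raw raw0
  rw [e1, e2]
  have hfD := Δ.fD i
  have hfe := Δ.f_eq i
  have e3 : Δ.RR i l (Δ.zf (Δ.B w).2) = - Δ.RR i (l+1) (Δ.zf w) := by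
    rw [← RR_shift, ← map_neg]
    congr 1
    funext x k
    rw [B_snd]; rfl
  rw [e3]
  split_ifs with hl
  · unfold tR
    rw [dif_pos h3, B_fst]
    simp only [top, LinearMap.sub_apply]
    rw [← hl]
    have hm : (i+1) * (Δ.δ+1) = i * (Δ.δ+1) + (Δ.δ+1) := by ring
    split_ifs with hi
    · have hlδ : l = Δ.δ := by omega
      have hs1 : Δ.b - (s-1) = (i+1) * (Δ.δ+1) := by omega
      unfold yp
      rw [if_pos (by omega), hs1, Nat.mul_div_cancel _ (Nat.succ_pos _), Nat.mul_mod_left]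
      ring
    · have : s - 1 = 0 := by omega
      rw [this]
      simp [yp]
  · rw [zero_add]
    have hs1 : Δ.b - (s-1) = (l + 1) + (Δ.δ+1) * i := by rw [mul_comm (Δ.δ+1)]; omega
    unfold yp
    rw [if_pos (by omega), hs1, Nat.add_mul_div_left _ _ (Nat.succ_pos _), Nat.add_mul_mod_self_left,
      Nat.div_eq_of_lt (by omega), Nat.mod_eq_of_lt (by omega), zero_add]

theorem hA2 (w : Δ.VV) : Δ.πU (Δ.A w) = mA2 Δ.H (Δ.πV w) := by
  ext j k
  change (if (k:ℕ) < Δ.η j then Δ.raw (Δ.o j + k + 1) (Δ.A w) else 0) +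
    (if (k:ℕ) = 0 then Δ.tI (Δ.A w).1 j else 0) - (if (k:ℕ) = Δ.η j then Δ.tI (Δ.A w).1 (j+1) else 0)
    = zext (Δ.πV w j) k
  have h1 := Δ.o_succ j
  have h2 := Δ.o_le (show (j:ℕ) + 1 ≤ Δ.M by omega)
  simp only [tI_A, ite_self, add_zero, sub_zero]
  split_ifs with hk
  · rw [raw_A _ _ _ (by omega) (by omega), zext_of_lt _ hk]
    rfl
  · rw [zext_of_ge _ (show Δ.H j ≤ k from by have hH : Δ.H j = Δ.η j := rfl; omega)]

theorem hB2 (w : Δ.VV) : Δ.πU (Δ.B w) = mB2 Δ.H (Δ.πV w) := by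
  ext j k
  change (if (k:ℕ) < Δ.η j then Δ.raw (Δ.o j + k + 1) (Δ.B w) else 0) +
    (if (k:ℕ) = 0 then Δ.tI (Δ.B w).1 j else 0) - (if (k:ℕ) = Δ.η j then Δ.tI (Δ.B w).1 (j+1) else 0)
    = if (k:ℕ) = 0 then 0 else - zext (Δ.πV w j) (k-1)
  have h1 := Δ.o_succ j
  have h2 := Δ.o_le (show (j:ℕ) + 1 ≤ Δ.M by omega)
  have hk : (k:ℕ) < Δ.η j + 1 := k.2
  have hH : Δ.H j = Δ.η j := rfl
  rw [tI_B _ _ _ (by omega), tI_B _ _ _ (by omega)]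
  have h3 : (k:ℕ) < Δ.η j → Δ.raw (Δ.o j + k + 1) (Δ.B w) = - Δ.yp (Δ.o j + k) (Δ.zf w) := by
    intro h
    rw [raw_B _ _ _ (by omega) (by omega)]; rfl
  have h4 : (k:ℕ) ≠ 0 → zext (Δ.πV w j) (k-1) = Δ.yp (Δ.o j + k) (Δ.zf w) := by
    intro h
    rw [zext_of_lt _ (by omega)]
    change Δ.yp (Δ.o j + (k - 1) + 1) _ = _
    rw [show Δ.o j + (k - 1) + 1 = Δ.o j + k by omega]
  by_cases hk0 : (k:ℕ) = 0
  · rw [if_pos hk0, if_pos hk0]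
    by_cases hη : (k:ℕ) < Δ.η j
    · rw [if_pos hη, if_neg (by omega), h3 hη, hk0]
      simp
    · rw [if_neg hη, if_pos (by omega), h1, show Δ.η j = 0 by omega]
      simp
  · rw [if_neg hk0, if_neg hk0, h4 hk0]
    by_cases hη : (k:ℕ) < Δ.η j
    · rw [if_pos hη, if_neg (by omega), h3 hη]
      simp
    · rw [if_neg hη, if_pos (by omega), h1, show Δ.η j = k by omega]
      simp

theorem πV_surj : Function.Surjective Δ.πV := by
  intro y
  let YT : ℕ → ℂ := fun t => ∑ j : Fin Δ.M,
    if Δ.o j ≤ t ∧ t < Δ.o j + Δ.η j then zext (y j) (t - Δ.o j) else 0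
  have hYT : ∀ (j : Fin Δ.M) (k : ℕ), k < Δ.η j → YT (Δ.o j + k) = zext (y j) k := by
    intro j k hk
    simp only [YT]
    rw [Fintype.sum_eq_single j]
    · rw [if_pos (by omega), Nat.add_sub_cancel_left]
    · intro j' hne
      rw [if_neg]
      rintro ⟨h1, h2⟩
      rcases lt_or_gt_of_ne hne with h | h
      · have h3 := Δ.o_mono (show (j':ℕ) + 1 ≤ j from h)
        rw [o_succ] at h3
        omega
      · have h3 := Δ.o_mono (show (j:ℕ) + 1 ≤ j' from h)
        rw [o_succ] at h3
        omega
  let YY : ℕ → ℕ → ℂ := fun i l => YT (Δ.b - 1 - (i * (Δ.δ+1) + l))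
  let wv : ℕ → ℕ → ℂ := fun i => Nat.rec (fun _ => 0) (fun i w l => YY i l + w (l + Δ.D i)) i
  have hwv : ∀ i l, wv (i+1) l = YY i l + wv i (l + Δ.D i) := fun i l => rfl
  refine ⟨fun x l => Sum.elim (fun _ => 0) (fun i : Fin (Δ.r+1) => wv i l) x, ?_⟩
  ext j k
  have h1 := Δ.o_succ j
  change Δ.yp (Δ.o j + k + 1) (Δ.zf (fun x l => Sum.elim (fun _ => 0) (fun i : Fin (Δ.r+1) => wv i l) x)) = _
  have h2 := Δ.o_le (show (j:ℕ) + 1 ≤ Δ.M by omega)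
  have hk : (k:ℕ) < Δ.η j := k.2
  obtain ⟨i, l, e1, e2, h3, h4, h5, h6, h7⟩ := Δ.div_data (Δ.o j + k + 1) (by omega) (by omega)
  unfold yp
  rw [if_pos (by omega), e1, e2, RR_apply]
  unfold vx zf
  rw [dif_pos (by omega), dif_pos (by omega), zext_of_lt _ (by omega), zext_of_lt _ (by omega),
    Finset.sum_eq_zero]
  · simp only [Sum.elim_inr]
    rw [hwv]
    have : Δ.b - 1 - (i * (Δ.δ+1) + l) = Δ.o j + k := by omega
    simp only [YY, this]
    rw [hYT j k hk, zext_fin]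
    ring
  · intro j' _
    split_ifs
    · unfold zext; split_ifs <;> simp
    · rfl

theorem πU_surj : Function.Surjective Δ.πU := by
  intro z
  let zl : ℕ → ℂ := fun j => if h : j < Δ.M then z ⟨j, h⟩ (Fin.last _) else 0
  -- the corrections, indexed by successor
  let τ : ℕ → ℂ := fun j => Nat.rec 0 (fun j t => (if Δ.η j = 0 then t else 0) - zl j) j
  have hτ : ∀ j, τ (j+1) = (if Δ.η j = 0 then τ j else 0) - zl j := fun j => rfl
  let s : Δ.UU := (Sum.elim (fun j => τ (j+1)) (fun _ => 0), 0)
  have hraw : ∀ t, Δ.raw t s = 0 := by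
    intro t
    unfold raw raw0 tR
    have : Δ.zf s.2 = 0 := by funext x k; simp [zf, s]
    rw [this, map_zero]
    simp [s]
  have htI : ∀ j, j ≤ Δ.M → Δ.tI s.1 j = τ j := by
    intro j hj
    unfold tI
    split_ifs with h
    · simp only [s, Sum.elim_inl]
      rw [show j - 1 + 1 = j by omega]
    · rw [show j = 0 by omega]; rfl
  obtain ⟨w, hw⟩ := Δ.πV_surj (fun j k => z j k.castSucc - Δ.πU s j k.castSucc)
  refine ⟨s + Δ.A w, ?_⟩
  rw [map_add, hA2, hw]
  ext j k
  have hs : ∀ k : Fin (Δ.η j + 1), Δ.πU s j k = (if (k:ℕ) = 0 then τ j else 0) -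
      (if (k:ℕ) = Δ.η j then τ (j+1) else 0) := by
    intro k
    change (if (k:ℕ) < Δ.η j then Δ.raw (Δ.o j + k + 1) s else 0) +
      (if (k:ℕ) = 0 then Δ.tI s.1 j else 0) - (if (k:ℕ) = Δ.η j then Δ.tI s.1 (j+1) else 0) = _
    rw [hraw, htI _ (by omega), htI _ (by omega)]
    simp
  change Δ.πU s j k + zext (fun k : Fin (Δ.η j) => z j k.castSucc - Δ.πU s j k.castSucc) k = z j k
  by_cases hk : (k:ℕ) < Δ.η j
  · rw [zext_of_lt _ hk]
    have : (⟨k, hk⟩ : Fin (Δ.η j)).castSucc = k := rfl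
    simp only [this]
    ring
  · rw [zext_of_ge _ (by omega), add_zero, hs]
    have hk' : (k:ℕ) = Δ.η j := by have : (k:ℕ) < Δ.η j + 1 := k.2; omega
    have hkl : k = Fin.last (Δ.η j) := Fin.ext hk'
    rw [if_pos hk', hτ, hk']
    simp only [zl]
    rw [dif_pos j.2, hkl]
    ring
end Dat

namespace Dat
variable (Δ : Dat)

noncomputable def zu (u : MV Δ.E) : ℕ → ℕ → ℂ := fun j k =>
  if h : j < Δ.N + 1 then zext (u ⟨j, h⟩) k else 0

theorem zu_add (u v : MV Δ.E) (j k : ℕ) : Δ.zu (u + v) j k = Δ.zu u j k + Δ.zu v j k := by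
  unfold zu; split_ifs <;> simp
theorem zu_smul (a : ℂ) (v : MV Δ.E) (j k : ℕ) : Δ.zu (a • v) j k = a * Δ.zu v j k := by
  unfold zu; split_ifs <;> simp
theorem zu_ge (u : MV Δ.E) (j k : ℕ) (h : Δ.e j + Δ.δ < k) : Δ.zu u j k = 0 := by
  unfold zu; split_ifs
  · exact zext_of_ge _ h
  · rfl
theorem zu_fin (u : MV Δ.E) (j : Fin (Δ.N+1)) (k : Fin (Δ.E j + 1)) : Δ.zu u j k = u j k := by
  unfold zu; rw [dif_pos j.2]; exact zext_fin _ k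

noncomputable def iV : MV Δ.E →ₗ[ℂ] Δ.VV where
  toFun u x l := Δ.W (Δ.zu u) x l
  map_add' u v := by
    ext x l
    rcases x with j | i
    · simp only [W, zu_add, Pi.add_apply]; ring
    · simp only [W, zu_add, Pi.add_apply]
  map_smul' a v := by
    ext x l
    rcases x with j | i
    · simp only [W, zu_smul, Pi.smul_apply, smul_eq_mul, RingHom.id_apply]; ring
    · simp only [W, zu_smul, Pi.smul_apply, smul_eq_mul, RingHom.id_apply]

noncomputable def iU : MU Δ.E →ₗ[ℂ] Δ.UU := Δ.A.comp (Δ.iV.comp (mA2 Δ.E))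

theorem zf_iV (u : MV Δ.E) (x : Δ.X) (k : ℕ) (hk : k ≤ Δ.δ) :
    zext (Δ.iV u x) k = Δ.W (Δ.zu u) x k := by
  rw [zext_of_lt _ (by omega)]; rfl

theorem zf_iV' (u : MV Δ.E) (x : Δ.X) (k : ℕ) (hk : k ≤ Δ.δ) :
    Δ.zf (Δ.iV u) x k = Δ.W (Δ.zu u) x k := Δ.zf_iV u x k hk

/-- indices used by `W` are controlled -/
theorem W_low (U V : ℕ → ℕ → ℂ) (x : Δ.X) (l : ℕ)
    (h : ∀ j k, j ≤ Δ.N → k ≤ Δ.e j + l → U j k = V j k) :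
    Δ.W U x l = Δ.W V x l := by
  rcases x with j | i
  · have := j.2
    simp only [W]
    rw [h _ _ (by omega) (by omega), h _ _ (by omega) (by omega)]
  · simp only [W]
    have h1 := Δ.c_succ (Δ.J i)
    have h2 := Δ.g_le_c i (by omega)
    exact h _ _ (Δ.J_le i) (by omega)

theorem W_zero (x : Δ.X) (l : ℕ) : Δ.W (fun _ _ => 0) x l = 0 := by
  rcases x with j | i <;> simp [W]

theorem W_low0 (U : ℕ → ℕ → ℂ) (x : Δ.X) (l : ℕ)
    (h : ∀ j k, j ≤ Δ.N → k ≤ Δ.e j + l → U j k = 0) : Δ.W U x l = 0 := by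
  rw [Δ.W_low U (fun _ _ => 0) x l h, W_zero]

theorem A_ext (w : Δ.VV) (z : Δ.UU) (h1 : ∀ h, (Δ.A w).1 h = z.1 h)
    (h2 : ∀ x (l : Fin Δ.δ), zext (w x) l = z.2 x l) : Δ.A w = z := by
  refine Prod.ext (funext h1) ?_
  funext x l
  exact h2 x l

theorem A_iV_zero (u : MV Δ.E) (hu : ∀ j k, j ≤ Δ.N → k < Δ.e j + Δ.δ → Δ.zu u j k = 0) :
    Δ.A (Δ.iV u) = 0 := by
  have low : ∀ x l, l < Δ.δ → Δ.W (Δ.zu u) x l = 0 := fun x l hl =>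
    Δ.W_low0 _ x l fun j k hj hk => hu j k hj (by omega)
  apply A_ext
  · intro h
    rw [A_fst]
    let U' : ℕ → ℕ → ℂ := fun j k => if k = 0 then 0 else Δ.zu u j (k-1)
    rw [Δ.top_congr h _ (Δ.W U'), top_W]; rfl
    intro x k hk
    rcases k with _ | k
    · rw [if_neg (by omega)]
      refine (Δ.W_low0 _ x 0 fun j k hj hk => ?_).symm
      simp only [U']
      split_ifs with h0
      · rfl
      · exact hu j _ hj (by omega)
    · rw [← W_shift]
      have e : (fun j k => U' j (k+1)) = Δ.zu u := by
        funext j k; simp [U']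
      rw [e]
      split_ifs with h0
      · rw [zf_iV _ _ _ _ le_rfl, show k = Δ.δ by omega]
      · rw [low x k (by omega)]
  · intro x l
    rw [zf_iV _ _ _ _ (by omega), low x l l.2]; rfl

theorem zu_mA2 (z : MU Δ.E) (j : Fin (Δ.N+1)) (k : ℕ) : Δ.zu (mA2 Δ.E z) j k = zext (z j) k := by
  unfold zu; rw [dif_pos j.2]
  by_cases h : k < Δ.E j + 1
  · rw [zext_of_lt _ h]; rfl
  · rw [zext_of_ge _ (show Δ.E j + 1 ≤ k by omega), zext_of_ge _ (by omega)]

theorem hA1 (u : MV Δ.E) : Δ.A (Δ.iV u) = Δ.iU (mA1 Δ.E u) := by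
  unfold iU
  simp only [LinearMap.comp_apply]
  rw [← sub_eq_zero, ← map_sub, ← map_sub]
  apply A_iV_zero
  intro j k hj hk
  obtain ⟨j, rfl⟩ : ∃ j' : Fin (Δ.N+1), (j':ℕ) = j := ⟨⟨j, by omega⟩, rfl⟩
  have hE : Δ.E j = Δ.e j + Δ.δ := rfl
  rw [sub_eq_add_neg, zu_add, ← neg_one_smul ℂ, zu_smul, zu_mA2, zext_of_lt _ (by omega)]
  unfold zu
  rw [dif_pos j.2]
  change _ + -1 * zext (u j) k = 0
  simp

theorem hB1 (u : MV Δ.E) : Δ.B (Δ.iV u) = Δ.iU (mB1 Δ.E u) := by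
  unfold iU
  simp only [LinearMap.comp_apply]
  have key : ∀ j k, j ≤ Δ.N → Δ.zu (mA2 Δ.E (mB1 Δ.E u)) j k = - Δ.zu u j (k+1) := by
    intro j k hj
    obtain ⟨j, rfl⟩ : ∃ j' : Fin (Δ.N+1), (j':ℕ) = j := ⟨⟨j, by omega⟩, rfl⟩
    have hE : Δ.E j = Δ.e j + Δ.δ := rfl
    rw [zu_mA2]
    unfold zu
    rw [dif_pos j.2]
    by_cases h : k < Δ.E j
    · rw [zext_of_lt _ h]; rfl
    · rw [zext_of_ge _ (by omega), zext_of_ge _ (show Δ.E j + 1 ≤ k + 1 by omega), neg_zero]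
  have hW : ∀ x l, Δ.W (Δ.zu (mA2 Δ.E (mB1 Δ.E u))) x l = - Δ.W (Δ.zu u) x (l+1) := by
    intro x l
    rw [Δ.W_low _ (fun j k => - Δ.zu u j (k+1)) x l fun j k hj _ => key j k hj, ← W_shift]
    rcases x with j | i <;> simp only [W]; ring
  symm
  apply A_ext
  · intro h
    rw [A_fst, B_fst, eq_comm, ← sub_eq_zero, ← map_sub, Δ.top_congr h _ (Δ.W (Δ.zu u)), top_W]
    intro x k hk
    simp only [Pi.sub_apply]
    rw [zf_iV _ _ _ _ le_rfl, hW]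
    by_cases h0 : k = Δ.δ + 1
    · rw [if_pos h0, h0]
      unfold zf
      rw [zext_of_ge _ le_rfl]; ring
    · rw [if_neg h0, zf_iV' _ _ _ _ (by omega), sub_zero]
  · intro x l
    rw [zf_iV _ _ _ _ (by omega), hW, ← zf_iV _ _ _ _ (by omega)]; rfl

theorem hV0 (u : MV Δ.E) : Δ.πV (Δ.iV u) = 0 := by
  ext j k
  have h1 := Δ.o_succ j
  have h2 := Δ.o_le (show (j:ℕ) + 1 ≤ Δ.M by omega)
  have hk : (k:ℕ) < Δ.η j := k.2
  change Δ.yp (Δ.o j + k + 1) (Δ.zf (Δ.iV u)) = 0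
  rw [Δ.yp_congr _ (by omega) _ (Δ.W (Δ.zu u)) fun x k hk => Δ.zf_iV' u x k hk, yp_W _ _ (by omega)]

theorem transport (U : ℕ → ℕ → ℂ) (hU : ∀ x l, l ≤ Δ.δ → Δ.W U x l = 0) (q a b : ℕ) (hab : a ≤ b)
    (hb : b ≤ Δ.N) (h1 : Δ.c b ≤ q) (h2 : q ≤ Δ.c (a+1) + Δ.δ) : U b (q - Δ.c b) = U a (q - Δ.c a) := by
  induction b, hab using Nat.le_induction with
  | base => rfl
  | succ b hab ih =>
    have h3 := Δ.c_succ b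
    have h4 := Δ.c_mono (show a + 1 ≤ b + 1 by omega)
    rw [← ih (by omega) (by omega)]
    have := hU (Sum.inl ⟨b, by omega⟩) (q - Δ.c (b+1)) (by omega)
    simp only [W] at this
    rw [sub_eq_zero] at this
    rw [this]; congr 1; omega

theorem iV_inj : Function.Injective Δ.iV := by
  rw [← LinearMap.ker_eq_bot, LinearMap.ker_eq_bot']
  intro u hu
  have hW : ∀ x l, l ≤ Δ.δ → Δ.W (Δ.zu u) x l = 0 := by
    intro x l hl
    rw [← zf_iV _ _ _ _ hl, hu]; exact zext_zero _
  ext j k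
  have hk : (k:ℕ) < Δ.e j + Δ.δ + 1 := k.2
  have hj := j.2
  rw [← Δ.zu_fin u j k]
  obtain ⟨q, hq⟩ : ∃ q, q = Δ.c j + k := ⟨_, rfl⟩
  have hqk : (k:ℕ) = q - Δ.c j := by omega
  have hc := Δ.c_succ j
  have hq2 : q ≤ Δ.c (Δ.N+1) + Δ.δ := by
    have := Δ.c_mono (show (j:ℕ) + 1 ≤ Δ.N + 1 by omega)
    omega
  let i := Nat.findGreatest (fun i => Δ.g i ≤ q) Δ.r
  have hir : i ≤ Δ.r := Nat.findGreatest_le _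
  have hgi : Δ.g i ≤ q := Nat.findGreatest_spec (P := fun i => Δ.g i ≤ q) (Nat.zero_le _)
    (by rw [g_zero]; omega)
  have hgi2 : q ≤ Δ.g i + Δ.δ := by
    by_cases h : i = Δ.r
    · rw [h, g_r]; exact hq2
    · have h3 : ¬ Δ.g (i+1) ≤ q := Nat.findGreatest_is_greatest (P := fun i => Δ.g i ≤ q) (n := Δ.r) (Nat.lt_succ_self i) (by omega)
      have := Δ.g_le' i
      omega
  have h0 := hW (Sum.inr ⟨i, by omega⟩) (q - Δ.g i) (by omega)
  simp only [W] at h0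
  rw [show Δ.g i + (q - Δ.g i) = q by omega] at h0
  rw [hqk, Pi.zero_apply, Pi.zero_apply, ← h0]
  have hcJ := Δ.c_J i
  have hcJ2 := Δ.g_le_c i hir
  rcases le_total (j:ℕ) (Δ.J i) with h | h
  · rw [Δ.transport (Δ.zu u) hW q j (Δ.J i) h (Δ.J_le i) (by omega) (by omega)]
  · rw [Δ.transport (Δ.zu u) hW q (Δ.J i) j h (by omega) (by omega) (by omega)]

theorem A_ker (w : Δ.VV) (hw : Δ.A w = 0) : (∀ x l, l < Δ.δ → zext (w x) l = 0) ∧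
    ∀ i (hi : i < Δ.r), zext (w (Sum.inr ⟨i, by omega⟩)) Δ.δ =
      if Δ.D i = 0 then zext (w (Sum.inr ⟨i+1, by omega⟩)) Δ.δ else 0 := by
  constructor
  · intro x l hl
    have := congrFun (congrFun (congrArg Prod.snd hw) x) ⟨l, hl⟩
    exact this
  · intro i hi
    have h := congrFun (congrArg Prod.fst hw) (Sum.inr ⟨i, hi⟩)
    rw [A_fst] at h
    simp only [top, LinearMap.sub_apply] at h
    have h0 : (if (i+1) * (Δ.δ+1) < Δ.b then Δ.RR (i+1) 0 else 0)
        (fun x k => if k = Δ.δ+1 then zext (w x) Δ.δ else 0) = 0 := by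
      split_ifs with hi
      · have := Δ.f_next i hi
        refine Δ.RR_zero _ _ _ fun x k _ hk => if_neg (by omega)
      · rfl
    have hfD := Δ.fD i
    have hgD := Δ.gD i
    rw [h0, sub_zero, RR_apply, Finset.sum_eq_zero] at h
    · unfold vx at h
      rw [dif_pos (by omega), dif_pos (by omega), sub_zero] at h
      have h' := sub_eq_zero.1 h
      dsimp only at h'
      rw [if_pos hfD] at h'
      rw [← h']
      split_ifs <;> first | rfl | omega
    · intro j _
      split_ifs with h1 h2
      · have := Δ.c_gt i j h1.1
        have := (Δ.J_iff (i+1) (j+1) j.2).2 h1.2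
        omega
      · rfl
      · rfl

theorem back_rec (N : ℕ) (a : ℂ) (p : ℕ → ℂ → ℂ) : ∃ κ : ℕ → ℂ, κ N = a ∧
    ∀ j < N, κ j = p j (κ (j+1)) := by
  let κ' : ℕ → ℂ := fun t => Nat.rec a (fun t x => p (N - (t+1)) x) t
  refine ⟨fun j => κ' (N - j), ?_, ?_⟩
  · simp [κ']
  · intro j hj
    have e : N - j = (N - (j+1)) + 1 := by omega
    change κ' (N - j) = p j (κ' (N - (j+1)))
    rw [e]
    change p (N - (N - (j + 1) + 1)) (κ' (N - (j+1))) = _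
    congr 1; omega

theorem iU_inj : Function.Injective Δ.iU := by
  rw [← LinearMap.ker_eq_bot, LinearMap.ker_eq_bot']
  intro c hc
  change Δ.A (Δ.iV (mA2 Δ.E c)) = 0 at hc
  let U := Δ.zu (mA2 Δ.E c)
  obtain ⟨κ, hκN, hκ⟩ := back_rec Δ.N (Δ.W U (Sum.inr ⟨Δ.r, by omega⟩) Δ.δ)
    (fun j x => (if Δ.e (j+1) = 0 then x else 0) -
      (if h : j < Δ.N then Δ.W U (Sum.inl ⟨j, h⟩) Δ.δ else 0))
  let u : MV Δ.E := fun j k => if (k:ℕ) = Δ.e j + Δ.δ then κ j else 0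
  have hu : ∀ j k, j ≤ Δ.N → Δ.zu u j k = if k = Δ.e j + Δ.δ then κ j else 0 := by
    intro j k hj
    unfold zu
    rw [dif_pos (by omega)]
    by_cases h : k < Δ.e j + Δ.δ + 1
    · rw [zext_of_lt _ h]
    · rw [zext_of_ge _ (by change Δ.e j + Δ.δ + 1 ≤ k; omega), if_neg (by omega)]
  have hAu : Δ.A (Δ.iV u) = 0 := by
    apply A_iV_zero
    intro j k hj hk
    rw [hu j k hj, if_neg (by omega)]
  have hA : Δ.A (Δ.iV u - Δ.iV (mA2 Δ.E c)) = 0 := by rw [map_sub, hAu, hc, sub_zero]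
  obtain ⟨hlow, hrel⟩ := Δ.A_ker _ hA
  have hδ : ∀ x, zext ((Δ.iV u - Δ.iV (mA2 Δ.E c)) x) Δ.δ = Δ.W (Δ.zu u) x Δ.δ - Δ.W U x Δ.δ := by
    intro x
    rw [zext_of_lt _ (by omega)]; rfl
  have hinl : ∀ j : Fin Δ.N, Δ.W (Δ.zu u) (Sum.inl j) Δ.δ = Δ.W U (Sum.inl j) Δ.δ := by
    intro j
    have hj := j.2
    have h := hκ j j.2
    rw [dif_pos j.2] at h
    change Δ.zu u (j+1) Δ.δ - Δ.zu u j (Δ.e j + Δ.δ) = _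
    rw [hu _ _ (by omega), hu _ _ (by omega), if_pos rfl, h]
    by_cases h0 : Δ.e (j+1) = 0
    · rw [if_pos (by omega), if_pos h0]; ring
    · rw [if_neg (by omega), if_neg h0]; ring
  have hr : Δ.W (Δ.zu u) (Sum.inr ⟨Δ.r, by omega⟩) Δ.δ = Δ.W U (Sum.inr ⟨Δ.r, by omega⟩) Δ.δ := by
    rw [← hκN]
    change Δ.zu u (Δ.J Δ.r) (Δ.g Δ.r + Δ.δ - Δ.c (Δ.J Δ.r)) = _
    have := Δ.c_succ Δ.N
    rw [J_r, g_r, hu _ _ le_rfl, if_pos (by omega)]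
  have hinr : ∀ i (hi : i ≤ Δ.r), zext ((Δ.iV u - Δ.iV (mA2 Δ.E c)) (Sum.inr ⟨i, by omega⟩)) Δ.δ = 0 := by
    have aux : ∀ t i (hi : i + t = Δ.r), zext ((Δ.iV u - Δ.iV (mA2 Δ.E c)) (Sum.inr ⟨i, by omega⟩)) Δ.δ = 0 := by
      intro t
      induction t with
      | zero =>
        intro i hi
        have hi' : i = Δ.r := by omega
        subst hi'
        rw [hδ, hr, sub_self]
      | succ t ih =>
        intro i hi
        rw [hrel i (by omega), ih (i+1) (by omega)]; simp
    intro i hi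
    exact aux (Δ.r - i) i (by omega)
  have hz : Δ.iV u - Δ.iV (mA2 Δ.E c) = 0 := by
    funext x l
    rw [← zext_fin ((Δ.iV u - Δ.iV (mA2 Δ.E c)) x) l]
    by_cases hl : (l:ℕ) < Δ.δ
    · exact hlow x l hl
    · rw [show (l:ℕ) = Δ.δ by omega]
      rcases x with j | i
      · rw [hδ, hinl, sub_self]; rfl
      · exact hinr i (by omega)
  have heq := Δ.iV_inj (sub_eq_zero.1 hz)
  ext j k
  have hk : (k:ℕ) < Δ.e j + Δ.δ := k.2
  have := Δ.zu_mA2 c j k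
  rw [← heq, hu _ _ (by omega), if_neg (by omega), zext_fin] at this
  rw [← this]; rfl

theorem sum_e : ∑ j : Fin (Δ.N+1), Δ.e j = off Δ.e (Δ.N+1) := by
  unfold off; exact Fin.sum_univ_eq_sum_range Δ.e _
theorem sum_η : ∑ j : Fin Δ.M, Δ.η j = off Δ.η Δ.M := by
  unfold off; exact Fin.sum_univ_eq_sum_range Δ.η _

theorem hdV : Module.finrank ℂ Δ.VV = Module.finrank ℂ (MV Δ.E) + Module.finrank ℂ (MU Δ.H) := by
  rw [finrank_MV, finrank_MU]
  have h := Δ.hsum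
  simp only [E, H, Finset.sum_add_distrib, sum_e, sum_η]
  rw [Module.finrank_pi_fintype]
  simp
  nlinarith

theorem hdU : Module.finrank ℂ Δ.UU = Module.finrank ℂ (MU Δ.E) + Module.finrank ℂ (MV Δ.H) := by
  rw [finrank_MV, finrank_MU]
  have h := Δ.hsum
  simp only [E, H, Finset.sum_add_distrib, sum_e, sum_η]
  rw [Module.finrank_prod, Module.finrank_pi_fintype, Module.finrank_pi_fintype]
  simp
  nlinarith

theorem kiso : KIso Δ.A Δ.B ((mA1 Δ.E).prodMap (mA2 Δ.H)) ((mB1 Δ.E).prodMap (mB2 Δ.H)) :=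
  kiso_of_exact Δ.A Δ.B _ _ _ _ Δ.iV Δ.iU Δ.πV Δ.πU Δ.iV_inj Δ.iU_inj Δ.πV_surj Δ.πU_surj Δ.hV0
    Δ.hdV Δ.hdU Δ.hA1 Δ.hB1 Δ.hA2 Δ.hB2 (mA1_surj _)
    (fun ZA ZB => model_split _ _ (mA1_surj _) Δ.H ZA ZB)

end Dat


theorem exists_orbit (m n d r a : ℕ) (hd : 1 ≤ d) (hr : r < m) (hr' : r < n) (ha : a ≤ r * d) :
    ∃ Q : Pol d m n, StrictEquiv (comp m n d Q) (Ga m n d r a) := by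
  obtain ⟨δ, rfl⟩ : ∃ δ, d = δ + 1 := ⟨d - 1, by omega⟩
  obtain ⟨N, rfl⟩ : ∃ N, n = N + (r + 1) := ⟨n - r - 1, by omega⟩
  obtain ⟨M, rfl⟩ : ∃ M, m = M + r := ⟨m - r, by omega⟩
  have hM : 0 < M := by omega
  have e1 : N + (r + 1) - r = N + 1 := by omega
  have e2 : M + r - r = M := by omega
  let b := r * (δ+1) - a
  let e : ℕ → ℕ := fun j => if j < a % (N+1) then a / (N+1) + 1 else a / (N+1)
  let η : ℕ → ℕ := fun j => if j < b % M then b / M + 1 else b / M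
  have he : off e (N+1) = a := by
    unfold off
    rw [← Fin.sum_univ_eq_sum_range]
    exact sum_bal (N+1) a (by omega)
  have hη : off η M = b := by
    unfold off
    rw [← Fin.sum_univ_eq_sum_range]
    exact sum_bal M b hM
  let Δ : Dat := ⟨N, r, M, δ, e, η, by rw [he, hη]; omega⟩
  let eX : Δ.X ≃ Fin (N + (r+1)) := finSumFinEquiv
  let eY : Δ.Y ≃ Fin (M + r) := finSumFinEquiv
  let Q : Pol (δ+1) (M+r) (N+(r+1)) := fun k i j => Δ.P k (eY.symm i) (eX.symm j)
  refine ⟨Q, ?_⟩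
  have h1 := kiso_comp (M+r) (N+(r+1)) δ eX eY Δ.P Q (fun _ _ _ => rfl)
  have h2 := Δ.kiso
  have h3 := kiso_Ga (M+r) (N+(r+1)) (δ+1) r a hd hr hr' ha
  rw [e1, e2] at h3
  exact strictEquiv_of_kiso ((h1.trans h2).trans h3.symm)



theorem closed_ker {T V W : Type} [TopologicalSpace T] [NormedAddCommGroup V] [NormedSpace ℂ V]
    [FiniteDimensional ℂ V] [NormedAddCommGroup W] [NormedSpace ℂ W] [FiniteDimensional ℂ W]
    (f : T → V →ₗ[ℂ] W) (hf : ∀ v, Continuous fun t => f t v) (c : ℕ) :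
    IsClosed {t | c ≤ Module.finrank ℂ (LinearMap.ker (f t))} := by
  let F : T → V →L[ℂ] W := fun t => LinearMap.toContinuousLinearMap (f t)
  have hF : Continuous F := by
    rw [continuous_clm_apply]
    intro v
    exact hf v
  have ho := (isOpen_setOfPred_nat_le_rank (𝕜 := ℂ) (E := V) (F := W)
    (Module.finrank ℂ V + 1 - c)).preimage hF
  rw [← isOpen_compl_iff]
  convert ho using 1
  ext t
  have h1 := LinearMap.finrank_range_add_finrank_ker (f t)
  have h2 : (((F t : V →L[ℂ] W) : V →ₗ[ℂ] W)).rank = (Module.finrank ℂ (LinearMap.range (f t)) : Cardinal) := by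
    exact (Module.finrank_eq_rank ℂ (LinearMap.range (f t))).symm
  simp only [Set.mem_compl_iff, Set.mem_setOf_eq, Set.mem_preimage]
  rw [h2, Nat.cast_le]
  omega

theorem cont_comp (m n d : ℕ) (v : Fin (n*d) → ℂ) :
    Continuous (fun P : Pol d m n => (comp m n d P).1.mulVecLin v) ∧
    Continuous (fun P : Pol d m n => (comp m n d P).2.mulVecLin v) := by
  constructor
  · refine continuous_pi fun i => ?_
    change Continuous (fun P : Pol d m n => ∑ j, compA m n d P i j * v j)
    refine continuous_finset_sum _ fun j _ => Continuous.mul ?_ continuous_const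
    unfold compA
    split_ifs
    · exact (continuous_apply_apply _ _).comp (continuous_apply _)
    all_goals exact continuous_const
  · refine continuous_pi fun i => ?_
    change Continuous (fun P : Pol d m n => ∑ j, compB m n d P i j * v j)
    refine continuous_finset_sum _ fun j _ => Continuous.mul ?_ continuous_const
    unfold compB
    split_ifs
    · exact (continuous_apply_apply _ _).comp (continuous_apply _)
    all_goals exact continuous_const

theorem cont_phi2 (m n d K : ℕ) (x : Fin (K+1) → Fin (n*d) → ℂ) :
    Continuous (fun P : Pol d m n => Phi2 (comp m n d P).1.mulVecLin (comp m n d P).2.mulVecLin K x) := by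
  refine continuous_pi fun t => ?_
  exact (cont_comp m n d _).1.add (cont_comp m n d _).2

theorem cont_phi1 (m n d K : ℕ) (x : Fin (K+1) → Fin (n*d) → ℂ) :
    Continuous (fun P : Pol d m n => Phi1 (comp m n d P).1.mulVecLin (comp m n d P).2.mulVecLin K x) :=
  (cont_phi2 m n d K x).prodMk ((cont_comp m n d _).2.prodMk (cont_comp m n d _).1)

theorem bal_le (N a : ℕ) (j : Fin N) : bal N a j ≤ a + 1 := by
  have := Nat.div_le_self a N
  unfold bal; split_ifs <;> omega

theorem orbit_vals (m n d r a K : ℕ) (hd : 1 ≤ d) (hr : r < m) (hr' : r < n) (ha : a ≤ r * d)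
    (hK : K = r * d + 1 + d) (P : Pol d m n) (hP : StrictEquiv (comp m n d P) (Ga m n d r a)) :
    Module.finrank ℂ (LinearMap.ker (Phi2 (comp m n d P).1.mulVecLin (comp m n d P).2.mulVecLin K)) =
      a + (n-r) * (d - 1 + K + 1) ∧
    Module.finrank ℂ (LinearMap.ker (Phi1 (comp m n d P).1.mulVecLin (comp m n d P).2.mulVecLin K)) + a
      = (n-r) * (K + 1 - (d - 1)) := by
  have h := (kiso_of_strictEquiv hP).trans (kiso_Ga m n d r a hd hr hr' ha)
  have hb := fun j => bal_le (n-r) a j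
  have hH : ∀ j, bal (m-r) (r*d-a) j ≤ K := by
    intro j
    have := bal_le (m-r) (r*d-a) j
    omega
  have hs := sum_bal (n-r) a (by omega)
  rw [finrank_ker_phi2 h, finrank_ker_phi1 h, finrank_ker2 _ _ _ hH, finrank_ker1 _ _ _ hH]
  · constructor
    · rw [Finset.sum_congr rfl (g := fun j => bal (n-r) a j + (d - 1 + K + 1)) fun j _ => by omega,
        Finset.sum_add_distrib, hs]
      simp
    · rw [show ∀ S, S + a = S + ∑ j, bal (n-r) a j from fun S => by rw [hs]]
      rw [← Finset.sum_add_distrib, Finset.sum_congr rfl (g := fun j => (K + 1 - (d - 1)))]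
      · simp
      · intro j _
        have := hb j
        omega
  · intro j
    have := hb j
    omega

theorem main_aux (m n d r a a' : ℕ) (hm : 2 ≤ m) (hn : 2 ≤ n)
    (hd : 1 ≤ d) (hr1 : 1 ≤ r) (hr2 : r ≤ min m n - 1)
    (ha : a ≤ r * d) (ha' : a' ≤ r * d) (hne : a ≠ a') :
    ¬ closure {P : Pol d m n | StrictEquiv (comp m n d P) (Ga m n d r a')}
        ⊆ closure {P : Pol d m n | StrictEquiv (comp m n d P) (Ga m n d r a)} := by
  intro hsub
  have hr : r < m := by omega
  have hr' : r < n := by omega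
  obtain ⟨Q, hQ⟩ := exists_orbit m n d r a' hd hr hr' ha'
  have hQc := hsub (subset_closure hQ)
  obtain ⟨K, hK⟩ : ∃ K, K = r * d + 1 + d := ⟨_, rfl⟩
  have hv' := orbit_vals m n d r a' K hd hr hr' ha' hK Q hQ
  have c2 := closed_ker (fun P : Pol d m n =>
    Phi2 (comp m n d P).1.mulVecLin (comp m n d P).2.mulVecLin K) (cont_phi2 m n d K)
      (a + (n-r) * (d - 1 + K + 1))
  have c1 := closed_ker (fun P : Pol d m n =>
    Phi1 (comp m n d P).1.mulVecLin (comp m n d P).2.mulVecLin K) (cont_phi1 m n d K)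
      ((n-r) * (K + 1 - (d - 1)) - a)
  have h2 := closure_minimal (fun P hP =>
    (orbit_vals m n d r a K hd hr hr' ha hK P hP).1.ge) c2 hQc
  have h1 := closure_minimal (fun P hP => (by
    have := (orbit_vals m n d r a K hd hr hr' ha hK P hP).2
    simp only [Set.mem_setOf_eq]
    omega)) c1 hQc
  obtain ⟨v2, v1⟩ := hv'
  have h2' := le_trans h2 v2.le
  have h1' := Nat.add_le_add_right h1 a'
  change _ ≤ Module.finrank ℂ (LinearMap.ker (Phi1 (comp m n d Q).1.mulVecLin (comp m n d Q).2.mulVecLin K)) + a' at h1'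
  rw [v1] at h1'
  clear h1 h2 v1 v2 c1 c2
  have h3 : a ≤ (n-r) * (K + 1 - (d - 1)) := by
    have := Nat.le_mul_of_pos_left (K + 1 - (d-1)) (show 0 < n - r by omega)
    omega
  generalize (n-r) * (K + 1 - (d - 1)) = x at *
  generalize (n-r) * (d - 1 + K + 1) = y at *
  omega

end

/-- For `a ≠ a'`, `closure(O_a)` does not contain `closure(O_{a'})`. -/
theorem closure_generic_not_subset (m n d r a a' : ℕ) (hm : 2 ≤ m) (hn : 2 ≤ n)
    (hd : 1 ≤ d) (hr1 : 1 ≤ r) (hr2 : r ≤ min m n - 1)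
    (ha : a ≤ r * d) (ha' : a' ≤ r * d) (hne : a ≠ a') :
    ¬ closure {P : Pol d m n | StrictEquiv (comp m n d P) (Ga m n d r a')}
        ⊆ closure {P : Pol d m n | StrictEquiv (comp m n d P) (Ga m n d r a)} :=
  main_aux m n d r a a' hm hn hd hr1 hr2 ha ha' hne

end MPoly
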